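/- arXiv:2507.05697 — 2 statements merged into one kernel-verified Lean document; each statement's English description precedes it below -/
import Mathlib

section
/- Let c ∈ (0, 2^{-7/3}) be a constant, let p = p(n) < c·n^{-1/3}, and let G ~ G_{n,p}. Fix constants K_2 > K_1 > −1/ln(2^7 c^3) and 0 < ε < 1/18. Then with high probability, for every integer 3 ≤ ℓ = ℓ(n) ≤ n^ε, there are no subgraphs H, C ⊆ G such that C is an ℓ-cycle, |V(H)| ∈ [K_1·ℓ·ln n, K_2·ℓ·ln n], and H activates C in G via a nice activation process. -/
namespace WSat

variable {V : Type} [Fintype V] [DecidableEq V]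

/-- The edges of the triangle recorded in an activation step `(a, b, c)`:
the step activates the edge `{a, b}` using the triangle `{a, b, c}`. -/
def triEdges (st : V × V × V) : Set (Sym2 V) :=
  {s(st.1, st.2.1), s(st.1, st.2.2), s(st.2.1, st.2.2)}

/-- The graph `H ∪ Δ₁ ∪ ⋯ ∪ Δ_s`. -/
def afterGraph (H : SimpleGraph V) (steps : List (V × V × V)) : SimpleGraph V :=
  H ⊔ SimpleGraph.fromEdgeSet {e | ∃ st ∈ steps, e ∈ triEdges st}

/-- `(H; Δ₁, …, Δ_s)` is a (`K₃`-bootstrap) activation process: at each step `i`, the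
step `(a, b, c)` adds the new edge `{a, b}` (not present before), which forms the triangle
`{a, b, c}` together with the two previously present edges `{a, c}` and `{b, c}`. -/
def IsValidProcess (H : SimpleGraph V) (steps : List (V × V × V)) : Prop :=
  ∀ (i : ℕ) (hi : i < steps.length),
    (steps.get ⟨i, hi⟩).1 ≠ (steps.get ⟨i, hi⟩).2.1 ∧
    ¬ (afterGraph H (steps.take i)).Adj (steps.get ⟨i, hi⟩).1 (steps.get ⟨i, hi⟩).2.1 ∧
    (afterGraph H (steps.take i)).Adj (steps.get ⟨i, hi⟩).1 (steps.get ⟨i, hi⟩).2.2 ∧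
    (afterGraph H (steps.take i)).Adj (steps.get ⟨i, hi⟩).2.1 (steps.get ⟨i, hi⟩).2.2

/-- The number of (non-isolated) vertices of `G`. -/
noncomputable def supportCard (G : SimpleGraph V) : ℕ := Nat.card G.support

/-- The number of edges of `G`. -/
noncomputable def edgeCard (G : SimpleGraph V) : ℕ := Nat.card G.edgeSet

/-- `con_A(e)`: the number of triangles of the process containing `e` that do not
activate `e`. -/
noncomputable def conA (steps : List (V × V × V)) (e : Sym2 V) : ℕ :=
  Nat.card {i : Fin steps.length //
    e = s((steps.get i).1, (steps.get i).2.2) ∨ e = s((steps.get i).2.1, (steps.get i).2.2)}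

open scoped Classical in
/-- `exc_A(e)` relative to the initial graph `H` and the target graph `C`. -/
noncomputable def excA (H C : SimpleGraph V) (steps : List (V × V × V)) (e : Sym2 V) : ℤ :=
  (conA steps e : ℤ) -
    (if e ∈ C.edgeSet then (if e ∈ H.edgeSet then 1 else 0)
     else (if e ∈ H.edgeSet then 2 else 1))

/-- `exc(A) = Σ_e exc_A(e)`, summed over the edges of `K(A)`. -/
noncomputable def excSum (H C : SimpleGraph V) (steps : List (V × V × V)) : ℤ :=
  ∑ᶠ e ∈ (afterGraph H steps).edgeSet, excA H C steps e

/-- A nice activation process from `H` activating `C` (that is, every edge of the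
activation complex has nonnegative excess). -/
def NiceProcess (H C : SimpleGraph V) (steps : List (V × V × V)) : Prop :=
  IsValidProcess H steps ∧ C ≤ afterGraph H steps ∧
    ∀ e ∈ (afterGraph H steps).edgeSet, 0 ≤ excA H C steps e

/-- A nice activation process from `H` activating `C` inside the ambient graph `G`. -/
def NiceActivation (G H C : SimpleGraph V) (steps : List (V × V × V)) : Prop :=
  NiceProcess H C steps ∧ afterGraph H steps ≤ G

/-- The subgraph consisting of the edges of the walk `w`. -/
def walkEdgeGraph {G : SimpleGraph V} {x y : V} (w : G.Walk x y) : SimpleGraph V :=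
  SimpleGraph.fromEdgeSet {e | e ∈ w.edges}

open scoped Classical in
/-- The probability that the binomial random graph `G_{n,p}` (on vertex set `Fin n`, each
of the `n.choose 2` possible edges present independently with probability `p`) belongs to
the set `A`. -/
noncomputable def gnpProb (n : ℕ) (p : ℝ) (A : Set (SimpleGraph (Fin n))) : ℝ :=
  ∑ G : SimpleGraph (Fin n),
    if G ∈ A then p ^ edgeCard G * (1 - p) ^ (n.choose 2 - edgeCard G) else 0

section Words

variable {α : Type*}

/-- Step `i` of the word `u` visits a new vertex. -/
def wNew (u : ℕ → α) (i : ℕ) : Prop := ∀ j ≤ i, u j ≠ u (i + 1)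

/-- The edge traversed in step `i`. -/
def wEdge (u : ℕ → α) (i : ℕ) : Sym2 α := s(u i, u (i + 1))

/-- Step `j` is the partner of step `i`: `j` is the discovery step of a tree edge, and `i` is
its second traversal. -/
def wPart (u : ℕ → α) (i j : ℕ) : Prop :=
  j < i ∧ wNew u j ∧ wEdge u j = wEdge u i ∧ ∀ k, j < k → k < i → wEdge u k ≠ wEdge u i

/-- `i` is the second traversal of a tree edge -/
def wSec (u : ℕ → α) (i : ℕ) : Prop := ∃ j, wPart u i j

/-- the step goes to the parent -/
def wUp (u : ℕ → α) (i : ℕ) : Prop := ∃ j < i, wNew u j ∧ u (j + 1) = u i ∧ u j = u (i + 1)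

open scoped Classical in
/-- discovery steps of open children of the current vertex -/
noncomputable def wOpen (u : ℕ → α) (i : ℕ) : Finset ℕ :=
  (Finset.range i).filter fun j =>
    wNew u j ∧ u j = u i ∧ ∀ k, j < k → k < i → wEdge u k ≠ wEdge u j

/-- the step goes to the unique open child -/
def wDown (u : ℕ → α) (i : ℕ) : Prop := ∃ j, wOpen u i = {j} ∧ u (j + 1) = u (i + 1)

/-- a step with an explicitly encoded target -/
def wX (u : ℕ → α) (i : ℕ) : Prop := ¬ wNew u i ∧ ¬ wUp u i ∧ ¬ wDown u i

theorem wNew_inj {u : ℕ → α} {i j : ℕ} (hi : wNew u i) (hj : wNew u j)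
    (h : u (i + 1) = u (j + 1)) : i = j := by
  rcases lt_trichotomy i j with hlt | rfl | hlt
  · exact absurd h (hj (i + 1) hlt)
  · rfl
  · exact absurd h.symm (hi (j + 1) hlt)

theorem wEdge_cases {u : ℕ → α} {i j : ℕ} (h : wEdge u j = wEdge u i) :
    (u j = u i ∧ u (j + 1) = u (i + 1)) ∨ (u j = u (i + 1) ∧ u (j + 1) = u i) := by
  simpa [wEdge] using h

theorem wEdge_ne_of_new {u : ℕ → α} {i j : ℕ} (hi : wNew u i) (hj : j < i) :
    wEdge u j ≠ wEdge u i := by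
  intro h
  rcases wEdge_cases h with ⟨_, h2⟩ | ⟨h1, _⟩
  · exact hi (j + 1) hj h2
  · exact hi j hj.le h1

theorem wPart_not_new {u : ℕ → α} {i j : ℕ} (h : wPart u i j) : ¬ wNew u i := fun hn =>
  wEdge_ne_of_new hn h.1 h.2.2.1

/-- The partner is unique. -/
theorem wPart_unique {u : ℕ → α} {i j j' : ℕ} (h : wPart u i j) (h' : wPart u i j') : j = j' := by
  rcases lt_trichotomy j j' with hlt | rfl | hlt
  · exact absurd (h.2.2.1.trans h'.2.2.1.symm) (wEdge_ne_of_new h'.2.1 hlt)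
  · rfl
  · exact absurd (h'.2.2.1.trans h.2.2.1.symm) (wEdge_ne_of_new h.2.1 hlt)

theorem wPart_inj {u : ℕ → α} {i i' j : ℕ} (h : wPart u i j) (h' : wPart u i' j) : i = i' := by
  rcases lt_trichotomy i i' with hlt | rfl | hlt
  · exact absurd (h.2.2.1.symm.trans h'.2.2.1) (h'.2.2.2 i h.1 hlt)
  · rfl
  · exact absurd (h'.2.2.1.symm.trans h.2.2.1) (h.2.2.2 i' h'.1 hlt)

open scoped Classical in
/-- partner function -/
noncomputable def wPi (u : ℕ → α) (i : ℕ) : ℕ := if h : wSec u i then h.choose else 0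

theorem wPi_spec {u : ℕ → α} {i : ℕ} (h : wSec u i) : wPart u i (wPi u i) := by
  unfold wPi; rw [dif_pos h]; exact h.choose_spec

/-- second traversal downwards -/
def wSD (u : ℕ → α) (i : ℕ) : Prop := wSec u i ∧ u (wPi u i) ≠ u (i + 1)

theorem wSD_eq {u : ℕ → α} {i : ℕ} (h : wSD u i) :
    u (wPi u i) = u i ∧ u (wPi u i + 1) = u (i + 1) := by
  rcases wEdge_cases (wPi_spec h.1).2.2.1 with h1 | h1
  · exact h1
  · exact absurd h1.1 h.2

theorem wSD_mem_open {u : ℕ → α} {i : ℕ} (h : wSD u i) : wPi u i ∈ wOpen u i := by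
  have hs := wPi_spec h.1
  simp only [wOpen, Finset.mem_filter, Finset.mem_range]
  refine ⟨hs.1, hs.2.1, (wSD_eq h).1, fun k h1 h2 => ?_⟩
  rw [hs.2.2.1]; exact hs.2.2.2 k h1 h2

/-- junk steps -/
def wJ (u : ℕ → α) (i : ℕ) : Prop := ¬ wNew u i ∧ ¬ wSec u i

theorem wX_cases {u : ℕ → α} {i : ℕ} (h : wX u i) :
    wJ u i ∨ (wSD u i ∧ 2 ≤ (wOpen u i).card) := by
  by_cases hs : wSec u i
  · right
    have hp := wPi_spec hs
    have hsd : wSD u i := by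
      refine ⟨hs, fun he => h.2.1 ?_⟩
      rcases wEdge_cases hp.2.2.1 with h1 | h1
      · exact absurd (h1.2.symm ▸ he) (hp.2.1 _ le_rfl)
      · exact ⟨_, hp.1, hp.2.1, h1.2, h1.1⟩
    refine ⟨hsd, ?_⟩
    by_contra hc
    have hm := wSD_mem_open hsd
    have hpos := Finset.card_pos.mpr ⟨_, hm⟩
    have h1 : (wOpen u i).card = 1 := by omega
    obtain ⟨j, hj⟩ := Finset.card_eq_one.mp h1
    rw [hj, Finset.mem_singleton] at hm
    exact h.2.2 ⟨j, hj, hm ▸ (wSD_eq hsd).2⟩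
  · exact Or.inl ⟨h.1, hs⟩

open scoped Classical in
theorem wKey (u : ℕ → α) (i : ℕ) :
    (wOpen u i).card + ((Finset.range i).filter fun k => wSD u k ∧ u k = u i).card ≤
      1 + ((Finset.range i).filter fun k => wJ u k ∧ u (k + 1) = u i).card := by
  set z := u i with hz
  let R := Finset.range i
  -- new departures
  let Nz := R.filter fun j => wNew u j ∧ u j = z
  let A := R.filter fun k => wSec u k ∧ u (wPi u k) = z
  let Aup := R.filter fun k => wSec u k ∧ u (wPi u k) = z ∧ u (k + 1) = z
  let Adn := R.filter fun k => wSD u k ∧ u k = z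
  let arrN := R.filter fun k => wNew u k ∧ u (k + 1) = z
  let arrD := R.filter fun k => wSD u k ∧ u (k + 1) = z
  let arrJ := R.filter fun k => wJ u k ∧ u (k + 1) = z
  let dep := R.filter fun k => u k = z
  let arr := R.filter fun k => u (k + 1) = z
  have h1 : (wOpen u i).card + A.card ≤ Nz.card := by
    have himg : A.card = (A.image (wPi u)).card := by
      rw [Finset.card_image_of_injOn]
      intro a ha b hb hab
      have ha' : wSec u a := by have := Finset.mem_coe.mp ha; simp only [A, Finset.mem_filter] at this; exact this.2.1
      have hb' : wSec u b := by have := Finset.mem_coe.mp hb; simp only [A, Finset.mem_filter] at this; exact this.2.1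
      have h1 := wPi_spec ha'
      have h2 := wPi_spec hb'
      have hab' : wPi u a = wPi u b := hab
      rw [hab'] at h1
      exact wPart_inj h1 h2
    have hdisj : Disjoint (wOpen u i) (A.image (wPi u)) := by
      rw [Finset.disjoint_left]
      intro j hj hj'
      simp only [A, R, Finset.mem_image, Finset.mem_filter, Finset.mem_range] at hj'
      obtain ⟨k, ⟨hk, hks, _⟩, rfl⟩ := hj'
      simp only [wOpen, Finset.mem_filter, Finset.mem_range] at hj
      have hp := wPi_spec hks
      exact hj.2.2.2 k hp.1 hk hp.2.2.1.symm
    rw [himg, ← Finset.card_union_of_disjoint hdisj]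
    apply Finset.card_le_card
    intro j hj
    rw [Finset.mem_union] at hj
    simp only [Nz, R, Finset.mem_filter, Finset.mem_range]
    rcases hj with hj | hj
    · simp only [wOpen, Finset.mem_filter, Finset.mem_range] at hj
      exact ⟨hj.1, hj.2.1, hj.2.2.1⟩
    · simp only [A, R, Finset.mem_image, Finset.mem_filter, Finset.mem_range] at hj
      obtain ⟨k, ⟨hk, hks, hkz⟩, rfl⟩ := hj
      have hp := wPi_spec hks
      exact ⟨hp.1.trans hk, hp.2.1, hkz⟩
  have h2 : Aup.card + Adn.card ≤ A.card := by
    have hdisj : Disjoint Aup Adn := by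
      rw [Finset.disjoint_left]
      intro k h1 h2
      simp only [Aup, Adn, Finset.mem_filter] at h1 h2
      exact h2.2.1.2 (h1.2.2.1.trans h1.2.2.2.symm)
    rw [← Finset.card_union_of_disjoint hdisj]
    apply Finset.card_le_card
    intro k hk
    simp only [Aup, Adn, A, Finset.mem_union, Finset.mem_filter] at hk ⊢
    rcases hk with hk | hk
    · exact ⟨hk.1, hk.2.1, hk.2.2.1⟩
    · exact ⟨hk.1, hk.2.1.1, (wSD_eq hk.2.1).1.trans hk.2.2⟩
  have h3 : Nz.card ≤ dep.card := by
    apply Finset.card_le_card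
    intro k hk
    simp only [Nz, dep, Finset.mem_filter] at hk ⊢
    exact ⟨hk.1, hk.2.2⟩
  have h4 : dep.card + 1 = arr.card + (if u 0 = z then 1 else 0) := by
    have e1 : ∑ k ∈ Finset.range (i + 1), (if u k = z then 1 else 0) = dep.card + 1 := by
      rw [Finset.sum_range_succ, if_pos hz.symm, Finset.card_filter]
    have e2 : ∑ k ∈ Finset.range (i + 1), (if u k = z then 1 else 0)
        = arr.card + (if u 0 = z then 1 else 0) := by
      rw [Finset.sum_range_succ', Finset.card_filter]
    rw [← e1, e2]
  have h5 : arr.card ≤ arrN.card + Aup.card + arrD.card + arrJ.card := by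
    have : arr ⊆ ((arrN ∪ Aup) ∪ arrD) ∪ arrJ := by
      intro k hk
      simp only [arr, arrN, Aup, arrD, arrJ, Finset.mem_union, Finset.mem_filter] at hk ⊢
      by_cases hn : wNew u k
      · exact Or.inl (Or.inl (Or.inl ⟨hk.1, hn, hk.2⟩))
      · by_cases hs : wSec u k
        · by_cases he : u (wPi u k) = z
          · exact Or.inl (Or.inl (Or.inr ⟨hk.1, hs, he, hk.2⟩))
          · exact Or.inl (Or.inr ⟨hk.1, ⟨hs, by rw [hk.2]; exact he⟩, hk.2⟩)
        · exact Or.inr ⟨hk.1, ⟨hn, hs⟩, hk.2⟩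
    calc arr.card ≤ _ := Finset.card_le_card this
      _ ≤ _ := by
        refine (Finset.card_union_le _ _).trans ?_
        gcongr
        refine (Finset.card_union_le _ _).trans ?_
        gcongr
        exact Finset.card_union_le _ _
  have h6 : arrN.card + (if u 0 = z then 1 else 0) ≤ 1 := by
    split_ifs with h0
    · have : arrN = ∅ := by
        rw [Finset.eq_empty_iff_forall_notMem]
        intro k hk
        simp only [arrN, Finset.mem_filter] at hk
        exact hk.2.1 0 (Nat.zero_le _) (h0.trans hk.2.2.symm)
      simp [this]
    · rw [add_zero, Finset.card_le_one]
      intro a ha b hb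
      simp only [arrN, Finset.mem_filter] at ha hb
      exact wNew_inj ha.2.1 hb.2.1 (ha.2.2.trans hb.2.2.symm)
  have h7 : arrD.card ≤ 1 := by
    rw [Finset.card_le_one]
    intro a ha b hb
    simp only [arrD, Finset.mem_filter] at ha hb
    have pa := wPi_spec ha.2.1.1
    have pb := wPi_spec hb.2.1.1
    have := wNew_inj pa.2.1 pb.2.1
      (((wSD_eq ha.2.1).2.trans ha.2.2).trans ((wSD_eq hb.2.1).2.trans hb.2.2).symm)
    rw [this] at pa
    exact wPart_inj pa pb
  change (wOpen u i).card + Adn.card ≤ 1 + arrJ.card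
  omega

open scoped Classical in
theorem wAmb_fiber (u : ℕ → α) (L : ℕ) (z : α) :
    ((Finset.range L).filter fun k => (wSD u k ∧ 2 ≤ (wOpen u k).card) ∧ u k = z).card ≤
      2 * ((Finset.range L).filter fun k => wJ u k ∧ u (k + 1) = z).card := by
  set Am := (Finset.range L).filter fun k => (wSD u k ∧ 2 ≤ (wOpen u k).card) ∧ u k = z
  set Jz := (Finset.range L).filter fun k => wJ u k ∧ u (k + 1) = z
  let S := (Finset.range L).filter fun k => wSD u k ∧ u k = z
  have hAS : Am ⊆ S := by
    intro k hk
    simp only [Am, S, Finset.mem_filter] at hk ⊢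
    exact ⟨hk.1, hk.2.1.1, hk.2.2⟩
  have hmono : ∀ i ∈ S, ((Finset.range i).filter fun k => wJ u k ∧ u (k + 1) = u i).card ≤ Jz.card := by
    intro i hi
    simp only [S, Finset.mem_filter, Finset.mem_range] at hi
    apply Finset.card_le_card
    intro k hk
    simp only [Jz, Finset.mem_filter, Finset.mem_range] at hk ⊢
    exact ⟨hk.1.trans hi.1, hk.2.1, hk.2.2.trans hi.2.2⟩
  rcases Am.eq_empty_or_nonempty with he | ⟨i, hi⟩
  · simp [he]
  have hJ : 1 ≤ Jz.card := by
    have h1 := wKey u i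
    have h2 := hmono i (hAS hi)
    have h3 : 2 ≤ (wOpen u i).card := by
      simp only [Am, Finset.mem_filter] at hi
      exact hi.2.1.2
    omega
  have hS : S.card ≤ 1 + Jz.card := by
    have hne : S.Nonempty := ⟨i, hAS hi⟩
    set m := S.max' hne
    have hm : m ∈ S := S.max'_mem hne
    have hm' := hm
    simp only [S, Finset.mem_filter, Finset.mem_range] at hm'
    have h1 := wKey u m
    have h2 := hmono m hm
    have h3 : 1 ≤ (wOpen u m).card := Finset.card_pos.mpr ⟨_, wSD_mem_open hm'.2.1⟩
    have h4 : S.erase m ⊆ (Finset.range m).filter fun k => wSD u k ∧ u k = u m := by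
      intro k hk
      rw [Finset.mem_erase] at hk
      have hle : k ≤ m := S.le_max' k hk.2
      have hk2 := hk.2
      simp only [S, Finset.mem_filter, Finset.mem_range] at hk2
      simp only [Finset.mem_filter, Finset.mem_range]
      exact ⟨lt_of_le_of_ne hle hk.1, hk2.2.1, hk2.2.2.trans hm'.2.2.symm⟩
    have h5 := Finset.card_le_card h4
    rw [Finset.card_erase_of_mem hm] at h5
    omega
  have := Finset.card_le_card hAS
  omega

open scoped Classical in
theorem wX_card_le_J (u : ℕ → α) (L : ℕ) :
    ((Finset.range L).filter (wX u)).card ≤ 3 * ((Finset.range L).filter (wJ u)).card := by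
  let Am := (Finset.range L).filter fun k => wSD u k ∧ 2 ≤ (wOpen u k).card
  let J := (Finset.range L).filter (wJ u)
  have h1 : ((Finset.range L).filter (wX u)).card ≤ J.card + Am.card := by
    refine le_trans (Finset.card_le_card ?_) (Finset.card_union_le _ _)
    intro k hk
    simp only [J, Am, Finset.mem_union, Finset.mem_filter] at hk ⊢
    rcases wX_cases hk.2 with h | h
    · exact Or.inl ⟨hk.1, h⟩
    · exact Or.inr ⟨hk.1, h⟩
  have h2 : Am.card ≤ 2 * J.card := by
    let T := (Finset.range (L + 1)).image u
    have e1 : Am.card = ∑ z ∈ T, (Am.filter fun k => u k = z).card := by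
      apply Finset.card_eq_sum_card_fiberwise
      intro k hk
      have hk := Finset.mem_coe.mp hk
      simp only [Am, Finset.mem_filter, Finset.mem_range] at hk
      exact Finset.mem_coe.mpr (Finset.mem_image_of_mem u (Finset.mem_range.mpr (by omega)))
    have e2 : J.card = ∑ z ∈ T, (J.filter fun k => u (k + 1) = z).card := by
      apply Finset.card_eq_sum_card_fiberwise
      intro k hk
      have hk := Finset.mem_coe.mp hk
      simp only [J, Finset.mem_filter, Finset.mem_range] at hk
      exact Finset.mem_coe.mpr (Finset.mem_image.mpr ⟨k + 1, (Finset.mem_range.mpr (by omega)), rfl⟩)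
    rw [e1, e2, Finset.mul_sum]
    apply Finset.sum_le_sum
    intro z _
    have := wAmb_fiber u L z
    simpa only [Am, J, Finset.filter_filter] using this
  change _ ≤ 3 * J.card
  omega

open scoped Classical in
theorem wNew_card (u : ℕ → α) (L : ℕ) :
    ((Finset.range L).filter (wNew u)).card + 1 = ((Finset.range (L + 1)).image u).card := by
  induction L with
  | zero => simp
  | succ L ih =>
    rw [Finset.range_add_one (n := L + 1), Finset.image_insert, Finset.range_add_one (n := L), Finset.filter_insert]
    rw [Finset.range_add_one (n := L)] at ih
    by_cases h : wNew u L
    · rw [if_pos h, Finset.card_insert_of_notMem (by simp), Finset.card_insert_of_notMem, ← ih]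
      intro hm
      rw [← Finset.range_add_one] at hm
      obtain ⟨j, hj, he⟩ := Finset.mem_image.mp hm
      exact h j (by rw [Finset.mem_range] at hj; omega) he
    · rw [if_neg h, Finset.insert_eq_of_mem, ← ih]
      rw [wNew] at h
      push Not at h
      obtain ⟨j, hj, he⟩ := h
      rw [← Finset.range_add_one]
      exact Finset.mem_image.mpr ⟨j, Finset.mem_range.mpr (by omega), he⟩

open scoped Classical in
theorem wJ_card (u : ℕ → α) (L : ℕ) :
    ((Finset.range L).filter (wJ u)).card + 2 * ((Finset.range L).filter (wNew u)).card ≤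
      L + ((Finset.range L).filter fun i => ∀ k < L, wEdge u k = wEdge u i → k = i).card := by
  set J := (Finset.range L).filter (wJ u)
  set N := (Finset.range L).filter (wNew u)
  set M := (Finset.range L).filter fun i => ∀ k < L, wEdge u k = wEdge u i → k = i
  let S := (Finset.range L).filter (wSec u)
  have h1 : J.card + N.card + S.card = L := by
    have hJN : Disjoint J N := by
      rw [Finset.disjoint_left]; intro k h1 h2
      simp only [J, N, Finset.mem_filter] at h1 h2
      exact h1.2.1 h2.2
    have hJNS : Disjoint (J ∪ N) S := by
      rw [Finset.disjoint_left]; intro k h1 h2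
      simp only [J, N, S, Finset.mem_filter, Finset.mem_union] at h1 h2
      rcases h1 with h1 | h1
      · exact h1.2.2 h2.2
      · obtain ⟨j, hj⟩ := h2.2
        exact wPart_not_new hj h1.2
    rw [← Finset.card_union_of_disjoint hJN, ← Finset.card_union_of_disjoint hJNS]
    conv_rhs => rw [← Finset.card_range L]
    congr 1
    ext k
    simp only [J, N, S, Finset.mem_filter, Finset.mem_union, wJ]
    tauto
  have h2 : N.card ≤ S.card + M.card := by
    have : (N \ M).card ≤ S.card := by
      apply Finset.card_le_card_of_surjOn (wPi u)
      intro j hj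
      have hj := Finset.mem_coe.mp hj
      rw [Finset.mem_sdiff] at hj
      simp only [N, M, Finset.mem_filter, Finset.mem_range] at hj
      obtain ⟨⟨hjL, hjn⟩, hm⟩ := hj
      have hm : ∃ k, k < L ∧ wEdge u k = wEdge u j ∧ k ≠ j := by
        by_contra hc
        push Not at hc
        exact hm ⟨hjL, hc⟩
      have hfirst := Nat.find_spec hm
      have hmin := fun k => @Nat.find_min _ _ hm k
      set k := Nat.find hm
      have hjk : j < k := by
        rcases lt_trichotomy j k with h | h | h
        · exact h
        · exact absurd h.symm hfirst.2.2
        · exact absurd hfirst.2.1 (wEdge_ne_of_new hjn h)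
      have hp : wPart u k j := by
        refine ⟨hjk, hjn, hfirst.2.1.symm, fun l h1 h2 he => ?_⟩
        exact hmin l h2 ⟨h2.trans hfirst.1, he.trans hfirst.2.1, h1.ne'⟩
      have hs : wSec u k := ⟨j, hp⟩
      refine ⟨k, ?_, wPart_unique (wPi_spec hs) hp⟩
      exact Finset.mem_coe.mpr (Finset.mem_filter.mpr ⟨Finset.mem_range.mpr hfirst.1, hs⟩)
    have h3 := Finset.card_le_card_sdiff_add_card (s := N) (t := M)
    omega
  omega

open scoped Classical in
/-- the combinatorial heart: number of explicitly encoded steps. -/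
theorem wX_card_le (u : ℕ → α) (L v r : ℕ)
    (hv : ((Finset.range (L + 1)).image u).card = v) (hr : L = 2 * (v - 1) + r)
    (hM : ((Finset.range L).filter fun i => ∀ k < L, wEdge u k = wEdge u i → k = i).card ≤ r) :
    ((Finset.range L).filter (wX u)).card ≤ 6 * r := by
  have h1 := wX_card_le_J u L
  have h2 := wJ_card u L
  have h3 := wNew_card u L
  omega

end Words

section Codes

variable {α : Type*}

/-- `j` is a first visit time. -/
def wFv (u : ℕ → α) (j : ℕ) : Prop := ∀ k < j, u k ≠ u j

theorem wNew_iff_fv (u : ℕ → α) (i : ℕ) : wNew u i ↔ wFv u (i + 1) :=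
  ⟨fun h k hk => h k (Nat.lt_succ_iff.mp hk), fun h k hk => h k (Nat.lt_succ_iff.mpr hk)⟩

open scoped Classical in
/-- the first visit time of `u i` -/
noncomputable def wFirst (u : ℕ → α) (i : ℕ) : ℕ := Nat.find (⟨i, rfl⟩ : ∃ j, u j = u i)

open scoped Classical in
theorem wFirst_spec (u : ℕ → α) (i : ℕ) :
    u (wFirst u i) = u i ∧ wFv u (wFirst u i) ∧ wFirst u i ≤ i := by
  have h : ∃ j, u j = u i := ⟨i, rfl⟩
  have h1 : u (wFirst u i) = u i := Nat.find_spec h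
  refine ⟨h1, fun k hk he => ?_, Nat.find_min' h rfl⟩
  exact Nat.find_min h hk (he.trans h1)

open scoped Classical in
theorem wFv_count (u : ℕ → α) (L : ℕ) :
    Nat.count (wFv u) (L + 1) = ((Finset.range (L + 1)).image u).card := by
  rw [← wNew_card, Nat.count_eq_card_filter_range]
  have h0 : wFv u 0 := fun k hk => absurd hk (Nat.not_lt_zero _)
  rw [Finset.card_filter, Finset.sum_range_succ', if_pos h0, Finset.card_filter]
  simp only [wNew_iff_fv]

open scoped Classical in
/-- The code letter of step `i`. -/
noncomputable def wCode (M : ℕ) (u : ℕ → α) (i : ℕ) : Fin 3 ⊕ Fin (M + 1) :=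
  if wNew u i then Sum.inl 0 else if wUp u i then Sum.inl 1 else if wDown u i then Sum.inl 2
  else Sum.inr (Fin.ofNat (M + 1) (Nat.count (wFv u) (wFirst u (i + 1))))

/-- The list of visited vertices in order. -/
noncomputable def wSig (M : ℕ) (u : ℕ → α) : Fin (M + 1) → α :=
  fun k => u (Nat.nth (wFv u) k)

open scoped Classical in
theorem wSig_first {M L : ℕ} {u : ℕ → α}
    (hv : ((Finset.range (L + 1)).image u).card = M + 1) {i : ℕ} (hi : i ≤ L) :
    wSig M u (Fin.ofNat (M + 1) (Nat.count (wFv u) (wFirst u i))) = u i := by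
  obtain ⟨h1, h2, h3⟩ := wFirst_spec u i
  have hlt : Nat.count (wFv u) (wFirst u i) < M + 1 := by
    rw [← hv, ← wFv_count]
    exact Nat.count_strict_mono h2 (by omega)
  unfold wSig
  rw [Fin.val_ofNat, Nat.mod_eq_of_lt hlt, Nat.nth_count h2, h1]

theorem wFirst_of_fv {u : ℕ → α} {i : ℕ} (h : wFv u i) : wFirst u i = i := by
  obtain ⟨h1, h2, h3⟩ := wFirst_spec u i
  rcases h3.lt_or_eq with hlt | he
  · exact absurd h1 (h _ hlt)
  · exact he

theorem wNew_congr {u u' : ℕ → α} {i : ℕ} (h : ∀ j ≤ i, u j = u' j) {j : ℕ} (hj : j < i) :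
    wNew u j ↔ wNew u' j := by
  unfold wNew
  rw [h (j + 1) hj]
  constructor
  · intro hh k hk; rw [← h k (by omega)]; exact hh k hk
  · intro hh k hk; rw [h k (by omega)]; exact hh k hk

theorem wFv_congr {u u' : ℕ → α} {i : ℕ} (h : ∀ j ≤ i, u j = u' j) {j : ℕ} (hj : j ≤ i) :
    wFv u j ↔ wFv u' j := by
  unfold wFv
  rw [h j hj]
  constructor
  · intro hh k hk; rw [← h k (by omega)]; exact hh k hk
  · intro hh k hk; rw [h k (by omega)]; exact hh k hk

theorem wEdge_congr {u u' : ℕ → α} {i : ℕ} (h : ∀ j ≤ i, u j = u' j) {j : ℕ} (hj : j < i) :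
    wEdge u j = wEdge u' j := by
  unfold wEdge
  rw [h j hj.le, h (j + 1) hj]

theorem wOpen_congr {u u' : ℕ → α} {i : ℕ} (h : ∀ j ≤ i, u j = u' j) :
    wOpen u i = wOpen u' i := by
  ext j
  simp only [wOpen, Finset.mem_filter, Finset.mem_range]
  refine and_congr_right fun hj => ?_
  rw [wNew_congr h hj, h j hj.le, h i le_rfl]
  refine and_congr_right fun _ => and_congr_right fun _ => ?_
  constructor
  · intro hh k h1 h2
    rw [← wEdge_congr h h2, ← wEdge_congr h hj]; exact hh k h1 h2
  · intro hh k h1 h2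
    rw [wEdge_congr h h2, wEdge_congr h hj]; exact hh k h1 h2

open scoped Classical in
theorem wCode_inj {M L : ℕ} {u u' : ℕ → α}
    (hv : ((Finset.range (L + 1)).image u).card = M + 1)
    (hv' : ((Finset.range (L + 1)).image u').card = M + 1)
    (hs : wSig M u = wSig M u') (hc : ∀ i < L, wCode M u i = wCode M u' i) :
    ∀ i ≤ L, u i = u' i := by
  have main : ∀ i ≤ L, ∀ j ≤ i, u j = u' j := by
    intro i
    induction i with
    | zero =>
      intro _ j hj
      obtain rfl : j = 0 := by omega
      have h0 : ∀ w : ℕ → α, wFv w 0 := fun w k hk => absurd hk (Nat.not_lt_zero _)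
      have e1 := wSig_first hv (Nat.zero_le L)
      have e2 := wSig_first hv' (Nat.zero_le L)
      rw [wFirst_of_fv (h0 _), Nat.count_zero] at e1 e2
      rw [← e1, ← e2, hs]
    | succ i ih =>
      intro hi j hj
      have ih := ih (by omega)
      rcases Nat.lt_or_ge j (i + 1) with hlt | hge
      · exact ih j (by omega)
      obtain rfl : j = i + 1 := by omega
      have hci := hc i (by omega)
      have hcount : Nat.count (wFv u) (i + 1) = Nat.count (wFv u') (i + 1) := by
        rw [Nat.count_eq_card_filter_range, Nat.count_eq_card_filter_range]
        congr 1
        apply Finset.filter_congr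
        intro k hk
        exact wFv_congr ih (by rw [Finset.mem_range] at hk; omega)
      have e1 := wSig_first hv hi
      have e2 := wSig_first hv' hi
      unfold wCode at hci
      by_cases hN : wNew u i
      · rw [if_pos hN] at hci
        have hN' : wNew u' i := by
          by_contra hN'
          rw [if_neg hN'] at hci
          split_ifs at hci <;> simp at hci
        rw [wFirst_of_fv ((wNew_iff_fv _ _).mp hN)] at e1
        rw [wFirst_of_fv ((wNew_iff_fv _ _).mp hN')] at e2
        rw [← e1, ← e2, hs, hcount]
      rw [if_neg hN] at hci
      have hN' : ¬ wNew u' i := by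
        intro hN'
        rw [if_pos hN'] at hci
        split_ifs at hci <;> simp at hci
      rw [if_neg hN'] at hci
      by_cases hU : wUp u i
      · rw [if_pos hU] at hci
        have hU' : wUp u' i := by
          by_contra hU'
          rw [if_neg hU'] at hci
          split_ifs at hci
          simp at hci
        obtain ⟨a, ha, hna, ha1, ha2⟩ := hU
        obtain ⟨b, hb, hnb, hb1, hb2⟩ := hU'
        have hnb' := (wNew_congr ih hb).mpr hnb
        have hab : a = b := by
          apply wNew_inj hna hnb'
          rw [ha1, ih (b + 1) hb, hb1, ih i le_rfl]
        subst hab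
        rw [← ha2, ← hb2]
        exact ih a ha.le
      rw [if_neg hU] at hci
      have hU' : ¬ wUp u' i := by
        intro hU'
        rw [if_pos hU'] at hci
        split_ifs at hci
        simp at hci
      rw [if_neg hU'] at hci
      by_cases hD : wDown u i
      · rw [if_pos hD] at hci
        have hD' : wDown u' i := by
          by_contra hD'
          rw [if_neg hD'] at hci
          simp at hci
        obtain ⟨a, ha, ha1⟩ := hD
        obtain ⟨b, hb, hb1⟩ := hD'
        rw [wOpen_congr ih, hb] at ha
        obtain rfl : b = a := by simpa using ha
        rw [← ha1, ← hb1]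
        apply ih
        have : b ∈ wOpen u' i := by rw [hb]; simp
        simp only [wOpen, Finset.mem_filter, Finset.mem_range] at this
        omega
      rw [if_neg hD] at hci
      have hD' : ¬ wDown u' i := by
        intro hD'
        rw [if_pos hD'] at hci
        simp at hci
      rw [if_neg hD'] at hci
      have hci := Sum.inr.inj hci
      rw [← e1, ← e2, hs, hci]
  exact fun i hi => main i hi i le_rfl

/-- The admissible code words. -/
noncomputable def codeSet (L M K : ℕ) : Finset (Fin L → Fin 3 ⊕ Fin (M + 1)) :=
  Finset.univ.filter fun f =>
    (Finset.univ.filter fun i => f i = Sum.inl 0).card = M ∧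
    (Finset.univ.filter fun i => (f i).isRight = true).card ≤ K

theorem codeSet_card (L M K : ℕ) (δ : ℝ) (h0 : 0 < δ) (h1 : δ ≤ 1) :
    ((codeSet L M K).card : ℝ) ≤ (4 + δ) ^ L / 2 ^ M * ((M + 1 : ℕ) / δ) ^ K := by
  let w : Fin 3 ⊕ Fin (M + 1) → ℝ := fun s =>
    (if s = Sum.inl 0 then 2 else 1) * (if s.isRight = true then δ / (M + 1 : ℕ) else 1)
  have hMpos : (0 : ℝ) < (M + 1 : ℕ) := by positivity
  have hM1 : (1 : ℝ) ≤ (M + 1 : ℕ) := by simp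
  have hq0 : 0 < δ / (M + 1 : ℕ) := by positivity
  have hq1 : δ / (M + 1 : ℕ) ≤ 1 := by rw [div_le_one hMpos]; linarith
  have hw0 : ∀ s, 0 ≤ w s := by
    intro s
    simp only [w]
    split_ifs <;> positivity
  have hsum : ∑ s, w s = 4 + δ := by
    rw [Fintype.sum_sum_type]
    simp only [w, Fin.sum_univ_three]
    simp
    field_simp
    norm_num
  have hprod : ∀ f : Fin L → Fin 3 ⊕ Fin (M + 1), f ∈ codeSet L M K →
      2 ^ M * (δ / (M + 1 : ℕ)) ^ K ≤ ∏ i, w (f i) := by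
    intro f hf
    simp only [codeSet, Finset.mem_filter, Finset.mem_univ, true_and] at hf
    simp only [w]
    rw [Finset.prod_mul_distrib, Finset.prod_ite, Finset.prod_ite]
    simp only [Finset.prod_const, one_pow, mul_one]
    rw [hf.1]
    gcongr ?_ * ?_
    exact pow_le_pow_of_le_one hq0.le hq1 hf.2
  have htot : ∑ f : Fin L → Fin 3 ⊕ Fin (M + 1), ∏ i, w (f i) = (4 + δ) ^ L := by
    have := Finset.prod_univ_sum (fun _ : Fin L => (Finset.univ : Finset (Fin 3 ⊕ Fin (M + 1))))
      (fun _ s => w s)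
    rw [Fintype.piFinset_univ] at this
    rw [← this, Finset.prod_const, hsum, Finset.card_univ, Fintype.card_fin]
  have hle : ((codeSet L M K).card : ℝ) * (2 ^ M * (δ / (M + 1 : ℕ)) ^ K) ≤ (4 + δ) ^ L := by
    rw [← htot, ← nsmul_eq_mul]
    refine (Finset.card_nsmul_le_sum _ _ _ hprod).trans ?_
    exact Finset.sum_le_sum_of_subset_of_nonneg (Finset.subset_univ _)
      fun f _ _ => Finset.prod_nonneg fun i _ => hw0 _
  have hpos : 0 < (2 : ℝ) ^ M * (δ / (M + 1 : ℕ)) ^ K := by positivity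
  rw [← le_div_iff₀ hpos] at hle
  refine hle.trans (le_of_eq ?_)
  rw [div_pow, div_pow]
  field_simp

theorem filter_card_congr {ι : Type*} [Fintype ι] (P Q : ι → Prop) [DecidablePred P]
    [DecidablePred Q] (h : ∀ i, P i ↔ Q i) :
    (Finset.univ.filter P).card = (Finset.univ.filter Q).card := by
  congr 1
  ext i
  simp [h]

open scoped Classical in
theorem wCode_mem {M L K : ℕ} {u : ℕ → α}
    (hv : ((Finset.range (L + 1)).image u).card = M + 1)
    (hX : ((Finset.range L).filter (wX u)).card ≤ K) :
    (fun i : Fin L => wCode M u i) ∈ codeSet L M K := by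
  have hN := wNew_card u L
  rw [hv] at hN
  have tr : ∀ P : ℕ → Prop, (Finset.univ.filter fun i : Fin L => P i).card =
      ((Finset.range L).filter P).card := by
    intro P
    rw [Finset.card_filter, Finset.card_filter,
      Fin.sum_univ_eq_sum_range (fun i => if P i then 1 else 0) L]
  have hi1 : ∀ i, wCode M u i = Sum.inl 0 ↔ wNew u i := by
    intro i
    unfold wCode
    split_ifs <;> simp_all
  have hi2 : ∀ i, (wCode M u i).isRight = true ↔ wX u i := by
    intro i
    unfold wCode wX
    split_ifs <;> simp_all
  simp only [codeSet, Finset.mem_filter, Finset.mem_univ, true_and]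
  constructor
  · refine Eq.trans ?_ (Nat.add_right_cancel hN)
    rw [← tr]
    exact filter_card_congr _ _ fun i => hi1 i
  · refine le_trans (le_of_eq ?_) hX
    rw [← tr]
    exact filter_card_congr _ _ fun i => hi2 i

theorem catalan_le (n : ℕ) : catalan n ≤ 4 ^ n := by
  rw [catalan_eq_centralBinom_div]
  refine (Nat.div_le_self _ _).trans ?_
  rw [Nat.centralBinom_eq_two_mul_choose]
  refine (Nat.choose_le_two_pow _ _).trans ?_
  rw [pow_mul]; norm_num

open scoped Classical in
theorem family_card [Fintype α] {β : Type*} (S : Finset β) (L M K : ℕ)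
    (sh : β → BinaryTree Unit) (wd : β → ℕ → α)
    (hsh : ∀ b ∈ S, (sh b).numNodes + 1 = L)
    (hwd : ∀ b ∈ S, ((Finset.range (L + 1)).image (wd b)).card = M + 1)
    (hX : ∀ b ∈ S, ((Finset.range L).filter (wX (wd b))).card ≤ K)
    (hinj : ∀ b ∈ S, ∀ b' ∈ S, sh b = sh b' → (∀ i ≤ L, wd b i = wd b' i) → b = b') :
    S.card ≤ 4 ^ L * Fintype.card α ^ (M + 1) * (codeSet L M K).card := by
  let T : Finset (BinaryTree Unit × (Fin (M + 1) → α) × (Fin L → Fin 3 ⊕ Fin (M + 1))) :=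
    BinaryTree.treesOfNumNodesEq (L - 1) ×ˢ (Finset.univ ×ˢ codeSet L M K)
  have h1 : S.card ≤ T.card := by
    apply Finset.card_le_card_of_injOn
      (fun b => (sh b, wSig M (wd b), fun i : Fin L => wCode M (wd b) i))
    · intro b hb
      have hb := Finset.mem_coe.mp hb
      apply Finset.mem_coe.mpr
      simp only [T, Finset.mem_product, Finset.mem_univ, true_and, BinaryTree.mem_treesOfNumNodesEq]
      refine ⟨?_, wCode_mem (hwd b hb) (hX b hb)⟩
      have := hsh b hb
      omega
    · intro b hb b' hb' he
      have hb := Finset.mem_coe.mp hb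
      have hb' := Finset.mem_coe.mp hb'
      simp only [Prod.mk.injEq] at he
      refine hinj b hb b' hb' he.1 (wCode_inj (hwd b hb) (hwd b' hb') he.2.1 ?_)
      intro i hi
      exact congrFun he.2.2 ⟨i, hi⟩
  refine h1.trans ?_
  simp only [T, Finset.card_product, Finset.card_univ, Fintype.card_fun, Fintype.card_fin,
    BinaryTree.treesOfNumNodesEq_card_eq_catalan]
  rw [← mul_assoc]
  gcongr
  exact (catalan_le _).trans (Nat.pow_le_pow_right (by norm_num) (by omega))

end Codes

section Trees
set_option linter.unusedSectionVars false
variable {V : Type} [Fintype V] [DecidableEq V]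

/-- In-order list of labels. -/
def inord : BinaryTree V → List V
  | .nil => []
  | .node c l r => inord l ++ c :: inord r

/-- Leaf edges of a labelled binary tree with root edge `{a, b}`. -/
def lf : BinaryTree V → V → V → Multiset (Sym2 V)
  | .nil, a, b => {s(a, b)}
  | .node c l r, a, b => lf l a c + lf r c b

/-- All edges of a labelled binary tree with root edge `{a, b}`. -/
def edg : BinaryTree V → V → V → Set (Sym2 V)
  | .nil, a, b => {s(a, b)}
  | .node c l r, a, b => {s(a, b)} ∪ (edg l a c ∪ edg r c b)

/-- All edges, not counting the ones of the first `k` nodes of the right spine. -/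
def spE : ℕ → BinaryTree V → V → V → Set (Sym2 V)
  | 0, t, a, b => edg t a b
  | _ + 1, .nil, _, _ => ∅
  | k + 1, .node c l r, a, b => edg l a c ∪ spE k r c b

/-- Length of the right spine. -/
def spLen : BinaryTree V → ℕ
  | .nil => 0
  | .node _ _ r => spLen r + 1

theorem length_inord (t : BinaryTree V) : (inord t).length = t.numNodes := by
  induction t with
  | nil => rfl
  | node c l r hl hr => simp [inord, hl, hr]; omega

theorem numNodes_map' (t : BinaryTree V) : (t.map fun _ => ()).numNodes = t.numNodes := by
  induction t with
  | nil => rfl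
  | node c l r hl hr => simp [BinaryTree.map, hl, hr]

theorem tree_ext {t t' : BinaryTree V} (h : t.map (fun _ => ()) = t'.map (fun _ => ()))
    (hi : inord t = inord t') : t = t' := by
  induction t generalizing t' with
  | nil =>
    cases t' with
    | nil => rfl
    | node c l r => simp [BinaryTree.map] at h
  | node c l r hl hr =>
    cases t' with
    | nil => simp [BinaryTree.map] at h
    | node c' l' r' =>
      simp only [BinaryTree.map, BinaryTree.node.injEq, true_and] at h
      simp only [inord] at hi
      have hlen : (inord l).length = (inord l').length := by
        rw [length_inord, length_inord, ← numNodes_map' l, ← numNodes_map' l', h.1]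
      obtain ⟨h1, h2⟩ := List.append_inj hi hlen
      rw [List.cons.injEq] at h2
      rw [hl h.1 h1, hr h.2 h2.2, h2.1]

theorem lf_sub_edg {t : BinaryTree V} {a b : V} {e : Sym2 V} (h : e ∈ lf t a b) :
    e ∈ edg t a b := by
  induction t generalizing a b with
  | nil => simpa [lf, edg] using h
  | node c l r hl hr =>
    simp only [lf, Multiset.mem_add] at h
    rcases h with h | h
    · exact Or.inr (Or.inl (hl h))
    · exact Or.inr (Or.inr (hr h))

theorem lf_sub_spE {k : ℕ} {t : BinaryTree V} {a b : V} {e : Sym2 V} (hk : k ≤ spLen t)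
    (h : e ∈ lf t a b) : e ∈ spE k t a b := by
  induction k generalizing t a b with
  | zero => exact lf_sub_edg h
  | succ k ih =>
    cases t with
    | nil => simp [spLen] at hk
    | node c l r =>
      simp only [lf, Multiset.mem_add] at h
      simp only [spLen, Nat.add_le_add_iff_right] at hk
      rcases h with h | h
      · exact Or.inl (lf_sub_edg h)
      · exact Or.inr (ih hk h)

theorem expand_edg {t : BinaryTree V} {a b x y : V} (c : V) (h : s(x, y) ∈ lf t a b) :
    ∃ t' : BinaryTree V, t'.numNodes = t.numNodes + 1 ∧ spLen t ≤ spLen t' ∧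
      lf t' a b + {s(x, y)} = lf t a b + {s(x, c)} + {s(y, c)} ∧
      edg t' a b = edg t a b ∪ {s(x, c), s(y, c)} := by
  induction t generalizing a b with
  | nil =>
    simp only [lf, Multiset.mem_singleton] at h
    refine ⟨.node c .nil .nil, by simp, by simp [spLen], ?_, ?_⟩
    · rw [h]
      rcases Sym2.eq_iff.mp h with ⟨rfl, rfl⟩ | ⟨rfl, rfl⟩
      · simp only [lf, Sym2.eq_swap (a := c)]
        abel
      · simp only [lf, Sym2.eq_swap (a := c)]
        abel
    · rcases Sym2.eq_iff.mp h with ⟨rfl, rfl⟩ | ⟨rfl, rfl⟩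
      · simp only [edg, Sym2.eq_swap (a := c)]
        rfl
      · simp only [edg, Sym2.eq_swap (a := c)]
        ext e; simp
  | node d l r hl hr =>
    simp only [lf, Multiset.mem_add] at h
    rcases h with h | h
    · obtain ⟨t', h1, h2, h3, h4⟩ := hl h
      refine ⟨.node d t' r, by simp [h1]; omega, by simp [spLen], ?_, ?_⟩
      · simp only [lf]
        rw [add_right_comm, h3]
        abel
      · simp only [edg, h4]
        ext e; simp; tauto
    · obtain ⟨t', h1, h2, h3, h4⟩ := hr h
      refine ⟨.node d l t', by simp [h1]; omega, by simpa [spLen] using h2, ?_, ?_⟩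
      · simp only [lf]
        rw [add_assoc, h3]
        abel
      · simp only [edg, h4]
        ext e; simp

theorem expand_spE {k : ℕ} {t : BinaryTree V} {a b x y : V} (c : V) (hk : k ≤ spLen t)
    (h : s(x, y) ∈ lf t a b) :
    ∃ t' : BinaryTree V, t'.numNodes = t.numNodes + 1 ∧ k ≤ spLen t' ∧
      lf t' a b + {s(x, y)} = lf t a b + {s(x, c)} + {s(y, c)} ∧
      spE k t' a b = spE k t a b ∪ {s(x, c), s(y, c)} := by
  induction k generalizing t a b with
  | zero =>
    obtain ⟨t', h1, h2, h3, h4⟩ := expand_edg c h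
    exact ⟨t', h1, Nat.zero_le _, h3, h4⟩
  | succ k ih =>
    cases t with
    | nil => simp [spLen] at hk
    | node d l r =>
      simp only [lf, Multiset.mem_add] at h
      simp only [spLen, Nat.add_le_add_iff_right] at hk
      rcases h with h | h
      · obtain ⟨t', h1, h2, h3, h4⟩ := expand_edg c h
        refine ⟨.node d t' r, by simp [h1]; omega, by simpa [spLen] using hk, ?_, ?_⟩
        · simp only [lf]
          rw [add_right_comm, h3]
          abel
        · simp only [spE, h4]
          ext e; simp; tauto
      · obtain ⟨t', h1, h2, h3, h4⟩ := ih hk h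
        refine ⟨.node d l t', by simp [h1]; omega, by simpa [spLen] using h2, ?_, ?_⟩
        · simp only [lf]
          rw [add_assoc, h3]
          abel
        · simp only [spE, h4]
          ext e; simp

/-- The comb tree of a walk. -/
theorem comb_exists {G : SimpleGraph V} {x y : V} (w : G.Walk x y) (hw : 1 ≤ w.length) :
    ∃ t : BinaryTree V, t.numNodes + 1 = w.length ∧ w.length - 1 ≤ spLen t ∧
      lf t x y = (w.edges : Multiset (Sym2 V)) ∧
      spE (w.length - 1) t x y = {e | e ∈ w.edges} := by
  induction w with
  | nil => simp at hw
  | @cons x z y h p ih =>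
    cases p with
    | nil =>
      refine ⟨.nil, by simp, by simp, by simp [lf], ?_⟩
      simp [spE, edg]
    | @cons _ z' _ h' p' =>
      obtain ⟨t, h1, h2, h3, h4⟩ := ih (by simp)
      refine ⟨.node z .nil t, ?_, ?_, ?_, ?_⟩
      · simp only [BinaryTree.numNodes, SimpleGraph.Walk.length_cons] at h1 ⊢
        omega
      · simp only [spLen, SimpleGraph.Walk.length_cons] at h2 ⊢
        omega
      · simp only [lf, h3]
        simp [SimpleGraph.Walk.edges_cons]
      · rw [SimpleGraph.Walk.length_cons, Nat.add_sub_cancel]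
        rw [SimpleGraph.Walk.length_cons, Nat.add_sub_cancel] at h4
        rw [SimpleGraph.Walk.length_cons]
        simp only [spE, h4, edg]
        ext e; simp

/-- number of non-activating uses of `e` -/
def conL : List (V × V × V) → Sym2 V → ℕ
  | [], _ => 0
  | st :: l, e => conL l e + ((if e = s(st.1, st.2.2) then 1 else 0) +
      (if e = s(st.2.1, st.2.2) then 1 else 0))

/-- number of activations of `e` -/
def actL : List (V × V × V) → Sym2 V → ℕ
  | [], _ => 0
  | st :: l, e => actL l e + (if e = s(st.1, st.2.1) then 1 else 0)

/-- Backwards expandability of a list of steps. -/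
def GoodL (m : Multiset (Sym2 V)) : List (V × V × V) → Prop
  | [] => True
  | st :: l => GoodL m l ∧ 1 ≤ m.count s(st.1, st.2.1) + conL l s(st.1, st.2.1) ∧
      actL l s(st.1, st.2.1) = 0

theorem conL_append (l l' : List (V × V × V)) (e : Sym2 V) :
    conL (l ++ l') e = conL l e + conL l' e := by
  induction l with
  | nil => simp [conL]
  | cons st l ih => simp only [List.cons_append, conL, ih]; omega

theorem conL_eq_zero {l : List (V × V × V)} {e : Sym2 V}
    (h : ∀ st ∈ l, e ≠ s(st.1, st.2.2) ∧ e ≠ s(st.2.1, st.2.2)) : conL l e = 0 := by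
  induction l with
  | nil => rfl
  | cons st l ih =>
    have h1 := h st (by simp)
    simp only [conL, if_neg h1.1, if_neg h1.2]
    simpa using ih fun st' hst' => h st' (by simp [hst'])

theorem actL_eq_zero {l : List (V × V × V)} {e : Sym2 V}
    (h : ∀ st ∈ l, e ≠ s(st.1, st.2.1)) : actL l e = 0 := by
  induction l with
  | nil => rfl
  | cons st l ih =>
    have h1 := h st (by simp)
    simp only [actL, if_neg h1]
    simpa using ih fun st' hst' => h st' (by simp [hst'])

theorem conA_eq {l : List (V × V × V)} (h : ∀ st ∈ l, st.1 ≠ st.2.1) (e : Sym2 V) :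
    conA l e = conL l e := by
  have h1 : conA l e = ∑ i : Fin l.length,
      if e = s((l.get i).1, (l.get i).2.2) ∨ e = s((l.get i).2.1, (l.get i).2.2) then 1 else 0 := by
    unfold conA
    rw [Nat.card_eq_fintype_card, Fintype.card_subtype, Finset.card_filter]
  rw [h1]
  clear h1
  induction l with
  | nil => simp [conL]
  | cons st l ih =>
    have ih := ih fun st' hst' => h st' (by simp [hst'])
    have h1 := h st (by simp)
    refine (Fin.sum_univ_succ (n := l.length) (fun i : Fin (l.length + 1) =>
      if e = s(((st :: l).get i).1, ((st :: l).get i).2.2) ∨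
        e = s(((st :: l).get i).2.1, ((st :: l).get i).2.2) then 1 else 0)).trans ?_
    simp only [List.get_cons_zero, List.get_cons_succ, conL]
    rw [← ih, add_comm]
    congr 1
    by_cases ha : e = s(st.1, st.2.2)
    · have hb : e ≠ s(st.2.1, st.2.2) := by
        intro hb
        rw [ha] at hb
        rcases Sym2.eq_iff.mp hb with ⟨h2, _⟩ | ⟨h2, h3⟩
        · exact h1 h2
        · exact h1 (h2.trans h3)
      simp only [eq_true ha, eq_false hb, if_true, if_false, true_or, or_true, or_self, add_zero, zero_add]
    · by_cases hb : e = s(st.2.1, st.2.2)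
      · simp only [eq_false ha, eq_true hb, if_true, if_false, true_or, or_true, or_self, add_zero, zero_add]
      · simp only [eq_false ha, eq_false hb, if_true, if_false, true_or, or_true, or_self, add_zero, zero_add]

theorem expand_all {k : ℕ} {t₀ : BinaryTree V} {a b : V} (hk : k ≤ spLen t₀)
    (l : List (V × V × V)) (hl : GoodL (lf t₀ a b) l) :
    ∃ t : BinaryTree V, t.numNodes = t₀.numNodes + l.length ∧ k ≤ spLen t ∧
      (∀ e, (lf t a b).count e + actL l e = (lf t₀ a b).count e + conL l e) ∧
      spE k t a b = spE k t₀ a b ∪ {e | ∃ st ∈ l, e ∈ triEdges st} := by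
  induction l with
  | nil => exact ⟨t₀, by simp, hk, by simp [actL, conL], by simp⟩
  | cons st l ih =>
    obtain ⟨hl1, hl2, hl3⟩ := hl
    obtain ⟨t, h1, h2, h3, h4⟩ := ih hl1
    have hmem : s(st.1, st.2.1) ∈ lf t a b := by
      rw [← Multiset.one_le_count_iff_mem]
      have := h3 s(st.1, st.2.1)
      omega
    obtain ⟨t', e1, e2, e3, e4⟩ := expand_spE st.2.2 h2 hmem
    refine ⟨t', by rw [e1, h1, List.length_cons]; omega, e2, ?_, ?_⟩
    · intro e
      have := congrArg (Multiset.count e) e3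
      simp only [Multiset.count_add, Multiset.count_singleton] at this
      have h3e := h3 e
      simp only [actL, conL]
      omega
    · have hin : s(st.1, st.2.1) ∈ spE k t a b := lf_sub_spE h2 hmem
      rw [e4]
      rw [h4] at hin ⊢
      have hsplit : {e | ∃ st' ∈ st :: l, e ∈ triEdges st'} =
          triEdges st ∪ {e | ∃ st' ∈ l, e ∈ triEdges st'} := by
        ext e
        simp only [Set.mem_union, Set.mem_ofPred_eq, List.mem_cons, exists_eq_or_imp]
      rw [hsplit]
      generalize {e | ∃ st' ∈ l, e ∈ triEdges st'} = Q at hin ⊢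
      generalize spE k t₀ a b = P at hin ⊢
      ext e
      simp only [Set.mem_union, triEdges, Set.mem_insert_iff, Set.mem_singleton_iff] at hin ⊢
      by_cases h : e = s(st.1, st.2.1)
      · rw [← h] at hin
        tauto
      · tauto

/-- Validity in terms of splittings. -/
def VP (H : SimpleGraph V) (l : List (V × V × V)) : Prop :=
  ∀ pre st suf, l = pre ++ st :: suf → st.1 ≠ st.2.1 ∧ ¬ (afterGraph H pre).Adj st.1 st.2.1 ∧
    (afterGraph H pre).Adj st.1 st.2.2 ∧ (afterGraph H pre).Adj st.2.1 st.2.2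

theorem VP_of_valid {H : SimpleGraph V} {l : List (V × V × V)} (h : IsValidProcess H l) :
    VP H l := by
  rintro pre st suf rfl
  have hi : pre.length < (pre ++ st :: suf).length := by simp
  have := h pre.length hi
  simpa using this

theorem after_adj {H : SimpleGraph V} {l : List (V × V × V)} {x y : V} :
    (afterGraph H l).Adj x y ↔ H.Adj x y ∨ ((∃ st ∈ l, s(x, y) ∈ triEdges st) ∧ x ≠ y) := by
  simp [afterGraph]

theorem VP.dropLast {H : SimpleGraph V} {l : List (V × V × V)} {st : V × V × V}
    (h : VP H (l ++ [st])) : VP H l := by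
  rintro pre st' suf rfl
  exact h pre st' (suf ++ [st]) (by simp)

theorem after_reach {H : SimpleGraph V} {l : List (V × V × V)} (hv : VP H l) {x y : V}
    (h : (afterGraph H l).Adj x y) : H.Reachable x y := by
  induction l using List.reverseRecOn generalizing x y with
  | nil =>
    rw [after_adj] at h
    rcases h with h | h
    · exact h.reachable
    · simp at h
  | append_singleton l st ih =>
    have ih := fun {x y} => @ih hv.dropLast x y
    have hst := hv l st [] rfl
    have hac := ih hst.2.2.1
    have hbc := ih hst.2.2.2
    have hab := hac.trans hbc.symm
    by_cases hxy : (afterGraph H l).Adj x y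
    · exact ih hxy
    rw [after_adj] at h hxy
    rcases h with h | ⟨⟨st', hst', he⟩, hne⟩
    · exact h.reachable
    rw [List.mem_append, List.mem_singleton] at hst'
    rcases hst' with hst' | rfl
    · exact absurd (Or.inr ⟨⟨st', hst', he⟩, hne⟩) hxy
    simp only [triEdges, Set.mem_insert_iff, Set.mem_singleton_iff, Sym2.eq_iff] at he
    rcases he with (⟨rfl, rfl⟩ | ⟨rfl, rfl⟩) | (⟨rfl, rfl⟩ | ⟨rfl, rfl⟩) | (⟨rfl, rfl⟩ | ⟨rfl, rfl⟩)
    · exact hab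
    · exact hab.symm
    · exact hac
    · exact hac.symm
    · exact hbc
    · exact hbc.symm

theorem after_edgeCard {H : SimpleGraph V} {l : List (V × V × V)} (hv : VP H l) :
    edgeCard H + l.length ≤ edgeCard (afterGraph H l) := by
  induction l using List.reverseRecOn with
  | nil => simp [afterGraph]
  | append_singleton l st ih =>
    have ih := ih hv.dropLast
    have hst := hv l st [] rfl
    have hlt : edgeCard (afterGraph H l) < edgeCard (afterGraph H (l ++ [st])) := by
      unfold edgeCard
      rw [Nat.card_coe_set_eq, Nat.card_coe_set_eq]
      apply Set.ncard_lt_ncard _ (Set.toFinite _)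
      rw [SimpleGraph.edgeSet_ssubset_edgeSet]
      refine lt_of_le_of_ne ?_ ?_
      · intro x y hxy
        rw [after_adj] at hxy ⊢
        rcases hxy with h | ⟨⟨st', hst', he⟩, hne⟩
        · exact Or.inl h
        · exact Or.inr ⟨⟨st', by simp [hst'], he⟩, hne⟩
      · intro he
        apply hst.2.1
        rw [he, after_adj]
        exact Or.inr ⟨⟨st, by simp, by simp [triEdges]⟩, hst.1⟩
    simp only [List.length_append, List.length_cons, List.length_nil]
    omega

theorem good_of_nice {H C : SimpleGraph V} {steps : List (V × V × V)} {m : Multiset (Sym2 V)}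
    (hn : NiceProcess H C steps) (hm : ∀ e, e ∈ C.edgeSet → 1 ≤ m.count e) :
    GoodL m steps := by
  have hv := VP_of_valid hn.1
  have hne : ∀ st ∈ steps, st.1 ≠ st.2.1 := by
    intro st hst
    obtain ⟨pre, suf, rfl⟩ := List.append_of_mem hst
    exact (hv pre st suf rfl).1
  have main : ∀ suf pre, steps = pre ++ suf → GoodL m suf := by
    intro suf
    induction suf with
    | nil => intro _ _; trivial
    | cons st suf ih =>
      intro pre hs
      have hst := hv pre st suf hs
      refine ⟨ih (pre ++ [st]) (by simp [hs]), ?_, ?_⟩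
      · have hF : s(st.1, st.2.1) ∈ (afterGraph H steps).edgeSet := by
          rw [SimpleGraph.mem_edgeSet, after_adj]
          exact Or.inr ⟨⟨st, by simp [hs], by simp [triEdges]⟩, hst.1⟩
        have hexc := hn.2.2 _ hF
        by_cases hC : s(st.1, st.2.1) ∈ C.edgeSet
        · have := hm _ hC
          omega
        have hH : s(st.1, st.2.1) ∉ H.edgeSet := by
          rw [SimpleGraph.mem_edgeSet]
          intro hH
          exact hst.2.1 (after_adj.mpr (Or.inl hH))
        unfold excA at hexc
        rw [if_neg hC, if_neg hH, conA_eq hne, hs, conL_append] at hexc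
        have h0 : conL pre s(st.1, st.2.1) = 0 := by
          apply conL_eq_zero
          intro st' hst'
          constructor
          · intro he
            exact hst.2.1 (after_adj.mpr (Or.inr ⟨⟨st', hst', by simp [triEdges, he]⟩, hst.1⟩))
          · intro he
            exact hst.2.1 (after_adj.mpr (Or.inr ⟨⟨st', hst', by simp [triEdges, he]⟩, hst.1⟩))
        have n1 : st.1 ≠ st.2.2 := hst.2.2.1.ne
        have n2 : st.2.1 ≠ st.2.2 := hst.2.2.2.ne
        have h1 : s(st.1, st.2.1) ≠ s(st.1, st.2.2) := by
          intro he
          rcases Sym2.eq_iff.mp he with ⟨_, h⟩ | ⟨h, _⟩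
          · exact n2 h
          · exact n1 h
        have h2 : s(st.1, st.2.1) ≠ s(st.2.1, st.2.2) := by
          intro he
          rcases Sym2.eq_iff.mp he with ⟨_, h⟩ | ⟨h, _⟩
          · exact n2 h
          · exact n1 h
        simp only [conL, h0, if_neg h1, if_neg h2] at hexc
        push_cast at hexc
        omega
      · apply actL_eq_zero
        intro st' hst' he
        obtain ⟨p', s', rfl⟩ := List.append_of_mem hst'
        have hst2 := hv (pre ++ st :: p') st' s' (by simp [hs])
        apply hst2.2.1
        rw [after_adj]
        exact Or.inr ⟨⟨st, by simp, by rw [← he]; simp [triEdges]⟩, hst2.1⟩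
  exact main steps [] rfl

theorem nice_tree {G H : SimpleGraph V} {steps : List (V × V × V)} {x : V} (wk : G.Walk x x)
    (hc : wk.IsCycle) (hn : NiceProcess H (walkEdgeGraph wk) steps) :
    ∃ t : BinaryTree V, t.numNodes + 1 = wk.length + steps.length ∧
      (afterGraph H steps).edgeSet = spE (wk.length - 1) t x x ∧
      (∀ e ∈ H.edgeSet, 2 ≤ (lf t x x).count e) ∧
      (∀ e ∈ lf t x x, e ∈ (afterGraph H steps).edgeSet) := by
  have hlen : 1 ≤ wk.length := by have := hc.three_le_length; omega
  obtain ⟨t₀, h1, h2, h3, h4⟩ := comb_exists wk hlen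
  have hCe : ∀ e, e ∈ (walkEdgeGraph wk).edgeSet ↔ e ∈ wk.edges := by
    intro e
    simp only [walkEdgeGraph, SimpleGraph.edgeSet_fromEdgeSet, Set.mem_sdiff, Set.mem_ofPred_eq]
    refine ⟨fun h => h.1, fun h => ⟨h, fun hd => ?_⟩⟩
    exact G.not_isDiag_of_mem_edgeSet (wk.edges_subset_edgeSet h) hd
  have hgood : GoodL (lf t₀ x x) steps := by
    apply good_of_nice hn
    intro e he
    rw [Multiset.one_le_count_iff_mem, h3]
    exact (hCe e).mp he
  obtain ⟨t, e1, e2, e3, e4⟩ := expand_all h2 steps hgood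
  have hv := VP_of_valid hn.1
  have hne : ∀ st ∈ steps, st.1 ≠ st.2.1 := by
    intro st hst
    obtain ⟨pre, suf, rfl⟩ := List.append_of_mem hst
    exact (hv pre st suf rfl).1
  have hcount : ∀ e ∈ H.edgeSet, 2 ≤ (lf t x x).count e := by
    intro e he
    have hF : e ∈ (afterGraph H steps).edgeSet := by
      refine SimpleGraph.edgeSet_subset_edgeSet.mpr ?_ he
      exact le_sup_left
    have hexc := hn.2.2 e hF
    have hact : actL steps e = 0 := by
      apply actL_eq_zero
      rintro st hst rfl
      obtain ⟨pre, suf, rfl⟩ := List.append_of_mem hst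
      exact (hv pre st suf rfl).2.1 (after_adj.mpr (Or.inl he))
    have h3e := e3 e
    unfold excA at hexc
    rw [conA_eq hne] at hexc
    by_cases hC : e ∈ (walkEdgeGraph wk).edgeSet
    · rw [if_pos hC, if_pos he] at hexc
      have : 1 ≤ (lf t₀ x x).count e := by
        rw [Multiset.one_le_count_iff_mem, h3]
        exact (hCe e).mp hC
      omega
    · rw [if_neg hC, if_pos he] at hexc
      omega
  have hset : (afterGraph H steps).edgeSet = spE (wk.length - 1) t x x := by
    apply Set.Subset.antisymm
    · intro e he
      by_cases hH : e ∈ H.edgeSet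
      · apply lf_sub_spE e2
        rw [← Multiset.one_le_count_iff_mem]
        have := hcount e hH
        omega
      · rw [e4]
        right
        induction e with
        | _ a b =>
          rw [SimpleGraph.mem_edgeSet] at he hH
          rw [after_adj] at he
          exact (he.resolve_left hH).1
    · rw [e4, h4]
      rintro e (he | ⟨st, hst, he⟩)
      · exact SimpleGraph.edgeSet_subset_edgeSet.mpr hn.2.1 ((hCe e).mpr he)
      · have hnd : ¬ e.IsDiag := by
          obtain ⟨pre, suf, rfl⟩ := List.append_of_mem hst
          have := hv pre st suf rfl
          simp only [triEdges, Set.mem_insert_iff, Set.mem_singleton_iff] at he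
          rcases he with rfl | rfl | rfl
          · simpa using this.1
          · simpa using this.2.2.1.ne
          · simpa using this.2.2.2.ne
        induction e with
        | _ a b =>
          rw [SimpleGraph.mem_edgeSet, after_adj]
          exact Or.inr ⟨⟨st, hst, he⟩, by simpa using hnd⟩
  refine ⟨t, by omega, hset, hcount, ?_⟩
  intro e he
  rw [hset]
  exact lf_sub_spE e2 he

end Trees

section Words2
set_option linter.unusedSectionVars false
variable {V : Type} [Fintype V] [DecidableEq V]

/-- Multiset of consecutive pairs of a list. -/
def consE : List V → Multiset (Sym2 V)
  | [] => 0
  | [_] => 0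
  | a :: b :: l => s(a, b) ::ₘ consE (b :: l)

theorem consE_append (l₁ l₂ : List V) (c : V) :
    consE (l₁ ++ c :: l₂) = consE (l₁ ++ [c]) + consE (c :: l₂) := by
  induction l₁ with
  | nil => simp [consE]
  | cons a l ih =>
    cases l with
    | nil => simp [consE]
    | cons b l =>
      simp only [List.cons_append, consE] at ih ⊢
      rw [ih, Multiset.cons_add]

theorem lf_consE (t : BinaryTree V) (a b : V) : lf t a b = consE (a :: inord t ++ [b]) := by
  induction t generalizing a b with
  | nil => simp [lf, inord, consE]
  | node c l r hl hr =>
    have := consE_append (a :: inord l) (inord r ++ [b]) c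
    simp only [lf, inord]
    rw [hl, hr]
    simpa using this.symm

theorem consE_range (l : List V) (d : V) :
    consE l = (((List.range (l.length - 1)).map
      fun i => s(l.getD i d, l.getD (i + 1) d) : List (Sym2 V)) : Multiset (Sym2 V)) := by
  induction l with
  | nil => simp [consE]
  | cons a l ih =>
    cases l with
    | nil => simp [consE]
    | cons b l =>
      simp only [consE, ih]
      simp only [List.length_cons, Nat.add_sub_cancel]
      rw [List.range_succ_eq_map]
      simp [Function.comp_def]

/-- The word of a tree. -/
def uw (t : BinaryTree V) (x : V) : ℕ → V := fun i => (x :: inord t ++ [x]).getD i x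

theorem lf_range (t : BinaryTree V) (x : V) :
    lf t x x = (Multiset.range (t.numNodes + 1)).map (wEdge (uw t x)) := by
  rw [lf_consE, consE_range _ x]
  simp only [List.length_append, List.length_cons, length_inord, List.length_nil,
    Nat.add_sub_cancel, zero_add]
  rfl

theorem uw_inj {t t' : BinaryTree V} {x x' : V} (L : ℕ) (ht : t.numNodes + 1 = L)
    (ht' : t'.numNodes + 1 = L) (hs : t.map (fun _ => ()) = t'.map (fun _ => ()))
    (hu : ∀ i ≤ L, uw t x i = uw t' x' i) : t = t' ∧ x = x' := by
  have hx : x = x' := by simpa [uw] using hu 0 (Nat.zero_le _)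
  subst hx
  refine ⟨tree_ext hs ?_, rfl⟩
  apply List.ext_getElem
  · rw [length_inord, length_inord]; omega
  · intro i h1 h2
    rw [length_inord] at h1 h2
    have := hu (i + 1) (by omega)
    simp only [uw, List.cons_append, List.getD_cons_succ] at this
    rw [List.getD_append _ _ _ _ (by rw [length_inord]; omega),
      List.getD_append _ _ _ _ (by rw [length_inord]; omega),
      List.getD_eq_getElem _ _ (by rw [length_inord]; omega),
      List.getD_eq_getElem _ _ (by rw [length_inord]; omega)] at this
    exact this

theorem reach_card {H : SimpleGraph V} (x : V) (S : Finset V) (hS : ∀ y ∈ S, H.Reachable x y) :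
    S.card ≤ edgeCard H + 1 := by
  classical
  have h1 := (H.connectedComponentMk x).connected_toSimpleGraph.card_vert_le_card_edgeSet_add_one
  have h2 : Nat.card (H.connectedComponentMk x).toSimpleGraph.edgeSet ≤ edgeCard H := by
    unfold edgeCard
    exact Nat.card_le_card_of_injective _
      (SimpleGraph.Embedding.mapEdgeSet
        (SimpleGraph.Embedding.induce (G := H) (H.connectedComponentMk x).supp)).injective
  have h3 : S.card ≤ Nat.card (H.connectedComponentMk x).supp := by
    rw [Nat.card_coe_set_eq, ← Set.ncard_coe_finset S]
    apply Set.ncard_le_ncard _ (Set.toFinite _)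
    intro y hy
    simp only [SimpleGraph.ConnectedComponent.mem_supp_iff, SimpleGraph.ConnectedComponent.eq]
    exact (hS y hy).symm
  exact h3.trans (h1.trans (by omega))

open scoped Classical in
theorem word_facts {G H : SimpleGraph V} {steps : List (V × V × V)} {x : V} (wk : G.Walk x x)
    (hc : wk.IsCycle) (hn : NiceProcess H (walkEdgeGraph wk) steps) :
    ∃ t : BinaryTree V, t.numNodes + 1 = wk.length + steps.length ∧
      (afterGraph H steps).edgeSet = spE (wk.length - 1) t x x ∧
      1 ≤ supportCard H ∧
      ((Finset.range (wk.length + steps.length + 1)).image (uw t x)).card = supportCard H ∧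
      2 * (supportCard H - 1) ≤ wk.length + steps.length ∧
      ((Finset.range (wk.length + steps.length)).filter (wX (uw t x))).card ≤
        6 * (wk.length + steps.length - 2 * (supportCard H - 1)) ∧
      supportCard H - 1 + steps.length ≤ edgeCard (afterGraph H steps) := by
  obtain ⟨t, ht, hF, h2, hsub⟩ := nice_tree wk hc hn
  set L := wk.length + steps.length with hL
  set u := uw t x with hu
  have hv := VP_of_valid hn.1
  rw [lf_range, ht] at h2 hsub
  have hadj : ∀ i < L, (afterGraph H steps).Adj (u i) (u (i + 1)) := by
    intro i hi
    have := hsub (wEdge u i) (Multiset.mem_map_of_mem _ (Multiset.mem_range.mpr hi))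
    exact this
  have hreach : ∀ i ≤ L, H.Reachable x (u i) := by
    intro i
    induction i with
    | zero => intro _; exact SimpleGraph.Reachable.refl _
    | succ i ih => exact fun hi => (ih (by omega)).trans (after_reach hv (hadj i (by omega)))
  have hLpos : 1 ≤ L := by omega
  have hcnt : ∀ e ∈ H.edgeSet, 2 ≤ ((Finset.range L).filter fun i => e = wEdge u i).card := by
    intro e he
    have := h2 e he
    rw [Multiset.count_map] at this
    refine this.trans (le_of_eq ?_)
    rw [Finset.card_def, Finset.filter_val, Finset.range_val]
  -- image is the support
  have himg : ((Finset.range (L + 1)).image u : Finset V) = H.support.toFinset := by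
    ext y
    simp only [Finset.mem_image, Finset.mem_range, Set.mem_toFinset]
    constructor
    · rintro ⟨i, hi, rfl⟩
      have : ∃ z, (afterGraph H steps).Adj (u i) z := by
        by_cases hiL : i < L
        · exact ⟨_, hadj i hiL⟩
        · have := hadj (i - 1) (by omega)
          rw [show i - 1 + 1 = i by omega] at this
          exact ⟨_, this.symm⟩
      obtain ⟨z, hz⟩ := this
      obtain ⟨w⟩ := after_reach hv hz
      cases w with
      | nil => exact absurd rfl hz.ne
      | cons h p => exact ⟨_, h⟩
    · rintro ⟨z, hz⟩
      have := hcnt s(y, z) hz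
      obtain ⟨i, hi⟩ := Finset.card_pos.mp (lt_of_lt_of_le (by norm_num : 0 < 2) this)
      rw [Finset.mem_filter, Finset.mem_range] at hi
      obtain ⟨hi, he⟩ := hi
      rcases Sym2.eq_iff.mp he with ⟨h, _⟩ | ⟨h, _⟩
      · exact ⟨i, by omega, h.symm⟩
      · exact ⟨i + 1, by omega, h.symm⟩
  have hcard : ((Finset.range (L + 1)).image u).card = supportCard H := by
    rw [himg, supportCard, Nat.card_eq_fintype_card, Set.toFinset_card]
  have hpos : 1 ≤ supportCard H := by
    rw [← hcard]
    exact Finset.card_pos.mpr ⟨u 0, Finset.mem_image_of_mem _ (by simp)⟩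
  have hvh : supportCard H ≤ edgeCard H + 1 := by
    rw [← hcard]
    apply reach_card x
    intro y hy
    obtain ⟨i, hi, rfl⟩ := Finset.mem_image.mp hy
    exact hreach i (by simpa [Nat.lt_succ_iff] using hi)
  have hone : 2 * edgeCard H +
      ((Finset.range L).filter fun i => ∀ k < L, wEdge u k = wEdge u i → k = i).card ≤ L := by
    have hA : 2 * edgeCard H ≤ ((Finset.range L).filter fun i => wEdge u i ∈ H.edgeSet).card := by
      have := Finset.card_mul_le_card_mul
        (s := H.edgeSet.toFinset)
        (t := (Finset.range L).filter fun i => wEdge u i ∈ H.edgeSet)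
        (fun e i => e = wEdge u i) (m := 2) (n := 1) ?_ ?_
      · simp only [mul_one] at this
        rw [edgeCard, Nat.card_eq_fintype_card, ← Set.toFinset_card]
        omega
      · intro e he
        refine (hcnt e (Set.mem_toFinset.mp he)).trans (Finset.card_le_card ?_)
        intro i hi
        rw [Finset.mem_filter] at hi
        simp only [Finset.bipartiteAbove, Finset.mem_filter]
        refine ⟨⟨hi.1, ?_⟩, hi.2⟩
        rw [← hi.2]
        exact Set.mem_toFinset.mp he
      · intro i hi
        refine (Finset.card_le_card (t := {wEdge u i}) ?_).trans (by simp)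
        intro e he
        simp only [Finset.bipartiteBelow, Finset.mem_filter] at he
        simp [he.2]
    have hdisj : Disjoint ((Finset.range L).filter fun i => wEdge u i ∈ H.edgeSet)
        ((Finset.range L).filter fun i => ∀ k < L, wEdge u k = wEdge u i → k = i) := by
      rw [Finset.disjoint_filter]
      intro i _ hi hone
      have := hcnt _ hi
      have h1 : ((Finset.range L).filter fun k => wEdge u i = wEdge u k).card ≤ 1 := by
        rw [Finset.card_le_one]
        intro a ha b hb
        rw [Finset.mem_filter, Finset.mem_range] at ha hb
        rw [hone a ha.1 ha.2.symm, hone b hb.1 hb.2.symm]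
      omega
    have := Finset.card_union_of_disjoint hdisj
    have h3 : (((Finset.range L).filter fun i => wEdge u i ∈ H.edgeSet) ∪
        ((Finset.range L).filter fun i => ∀ k < L, wEdge u k = wEdge u i → k = i)).card ≤ L := by
      refine (Finset.card_le_card (t := Finset.range L) ?_).trans (by simp)
      exact Finset.union_subset (Finset.filter_subset _ _) (Finset.filter_subset _ _)
    omega
  refine ⟨t, ht, hF, hpos, hcard, by omega, ?_, ?_⟩
  · apply wX_card_le u L (supportCard H) _ (by convert hcard) (by omega)
    have key : ((Finset.range L).filter fun i => ∀ k < L, wEdge u k = wEdge u i → k = i).card ≤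
        L - 2 * (supportCard H - 1) := by omega
    convert key
  · have := after_edgeCard hv
    omega

open scoped Classical in
/-- Possible activation complexes. -/
noncomputable def cplx (V : Type) [Fintype V] [DecidableEq V] (ℓ L M : ℕ) :
    Finset (SimpleGraph V) :=
  Finset.univ.filter fun F => M + (L - ℓ) ≤ edgeCard F ∧ ∃ (t : BinaryTree V) (x : V),
    t.numNodes + 1 = L ∧ F.edgeSet = spE (ℓ - 1) t x x ∧
    ((Finset.range (L + 1)).image (uw t x)).card = M + 1 ∧
    ((Finset.range L).filter (wX (uw t x))).card ≤ 6 * (L - 2 * M)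

theorem cplx_card (ℓ L M : ℕ) (δ : ℝ) (h0 : 0 < δ) (h1 : δ ≤ 1) :
    ((cplx V ℓ L M).card : ℝ) ≤ 4 ^ L * (Fintype.card V : ℝ) ^ (M + 1) *
      ((4 + δ) ^ L / 2 ^ M * (((M + 1 : ℕ) : ℝ) / δ) ^ (6 * (L - 2 * M))) := by
  classical
  have hS : ∀ F : {F // F ∈ cplx V ℓ L M}, ∃ (t : BinaryTree V) (x : V),
      t.numNodes + 1 = L ∧ F.1.edgeSet = spE (ℓ - 1) t x x ∧
      ((Finset.range (L + 1)).image (uw t x)).card = M + 1 ∧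
      ((Finset.range L).filter (wX (uw t x))).card ≤ 6 * (L - 2 * M) := by
    rintro ⟨F, hF⟩
    obtain ⟨t, x, h⟩ := (Finset.mem_filter.mp hF).2.2
    refine ⟨t, x, h.1, h.2.1, ?_, ?_⟩
    · convert h.2.2.1
    · convert h.2.2.2
  choose t x h using hS
  have := family_card (α := V) (cplx V ℓ L M).attach L M (6 * (L - 2 * M))
    (fun F => (t F).map fun _ => ()) (fun F => uw (t F) (x F))
    (fun F _ => by rw [numNodes_map']; exact (h F).1)
    (fun F _ => by convert (h F).2.2.1)
    (fun F _ => by convert (h F).2.2.2)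
    (fun F _ F' _ hs hw => by
      obtain ⟨e1, e2⟩ := uw_inj L (h F).1 (h F').1 hs hw
      apply Subtype.ext
      apply SimpleGraph.edgeSet_injective
      rw [(h F).2.1, (h F').2.1, e1, e2])
  rw [Finset.card_attach] at this
  calc ((cplx V ℓ L M).card : ℝ) ≤
      ((4 ^ L * Fintype.card V ^ (M + 1) * (codeSet L M (6 * (L - 2 * M))).card : ℕ) : ℝ) := by
        exact_mod_cast this
    _ ≤ _ := by
        push_cast
        gcongr
        exact_mod_cast codeSet_card L M (6 * (L - 2 * M)) δ h0 h1

theorem cplx_exists {G H : SimpleGraph V} {steps : List (V × V × V)} {x : V} (wk : G.Walk x x)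
    (hc : wk.IsCycle) (hn : NiceActivation G H (walkEdgeGraph wk) steps) :
    ∃ M r, supportCard H = M + 1 ∧ wk.length + steps.length = 2 * M + r ∧
      r ≤ 2 * Fintype.card V ^ 2 ∧
      ∃ F ∈ cplx V wk.length (2 * M + r) M, F ≤ G := by
  classical
  obtain ⟨t, h1, h2, h3, h4, h5, h6, h7⟩ := word_facts wk hc hn.1
  refine ⟨supportCard H - 1, wk.length + steps.length - 2 * (supportCard H - 1), by omega,
    by omega, ?_, afterGraph H steps, ?_, hn.2⟩
  · have e1 : edgeCard (afterGraph H steps) ≤ (Fintype.card V).choose 2 := by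
      unfold edgeCard
      rw [Nat.card_eq_fintype_card, ← SimpleGraph.edgeFinset_card]
      exact SimpleGraph.card_edgeFinset_le_card_choose_two
    have e2 : (Fintype.card V).choose 2 ≤ Fintype.card V ^ 2 := Nat.choose_le_pow _ _
    have e3 : wk.length ≤ Fintype.card V := by
      have h := hc.support_nodup.length_le_card
      simpa using h
    have e4 : Fintype.card V ≤ Fintype.card V ^ 2 := by nlinarith
    omega
  · simp only [cplx, Finset.mem_filter, Finset.mem_univ, true_and]
    have e : 2 * (supportCard H - 1) + (wk.length + steps.length - 2 * (supportCard H - 1)) =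
      wk.length + steps.length := by omega
    rw [e]
    refine ⟨by omega, t, x, h1, h2, by rw [h4]; omega, h6⟩

end Words2

section Prob

theorem wsum {ι : Type*} [DecidableEq ι] (U E : Finset ι) (hE : E ⊆ U) (p : ℝ) :
    ∑ t ∈ U.powerset.filter (E ⊆ ·), p ^ t.card * (1 - p) ^ (U.card - t.card) = p ^ E.card := by
  have h := Finset.sum_pow_mul_eq_add_pow p (1 - p) (U \ E)
  rw [add_sub_cancel, one_pow] at h
  refine Eq.trans ?_ (show p ^ E.card * ∑ t ∈ (U \ E).powerset,
    p ^ t.card * (1 - p) ^ ((U \ E).card - t.card) = p ^ E.card by rw [h, mul_one])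
  rw [Finset.mul_sum]
  symm
  apply Finset.sum_nbij' (fun t => E ∪ t) (fun t => t \ E)
  · intro t ht
    rw [Finset.mem_powerset] at ht
    simp only [Finset.mem_filter, Finset.mem_powerset]
    exact ⟨Finset.union_subset hE (ht.trans Finset.sdiff_subset), Finset.subset_union_left⟩
  · intro t ht
    simp only [Finset.mem_filter, Finset.mem_powerset] at ht ⊢
    exact Finset.sdiff_subset_sdiff ht.1 (Finset.Subset.refl _)
  · intro t ht
    rw [Finset.mem_powerset] at ht
    ext e
    have := @ht e
    simp only [Finset.mem_sdiff, Finset.mem_union] at this ⊢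
    tauto
  · intro t ht
    simp only [Finset.mem_filter, Finset.mem_powerset] at ht
    exact Finset.union_sdiff_of_subset ht.2
  · intro t ht
    rw [Finset.mem_powerset] at ht
    have hd : Disjoint E t := by
      rw [Finset.disjoint_left]
      intro e h1 h2
      exact (Finset.mem_sdiff.mp (ht h2)).2 h1
    have h1 := Finset.card_union_of_disjoint hd
    have h2 := Finset.card_sdiff_of_subset hE
    have h3 := Finset.card_le_card hE
    rw [h1, pow_add, h2, mul_assoc, Nat.sub_sub]

open scoped Classical in
theorem gnp_contains (n : ℕ) (p : ℝ) (F : SimpleGraph (Fin n)) :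
    ∑ G : SimpleGraph (Fin n), (if F ≤ G then
      p ^ edgeCard G * (1 - p) ^ (n.choose 2 - edgeCard G) else 0) = p ^ edgeCard F := by
  have hcard : ∀ G : SimpleGraph (Fin n), edgeCard G = G.edgeFinset.card := by
    intro G
    rw [edgeCard, Nat.card_eq_fintype_card, ← SimpleGraph.edgeFinset_card]
  have hU : (⊤ : SimpleGraph (Fin n)).edgeFinset.card = n.choose 2 := by
    rw [SimpleGraph.card_edgeFinset_top_eq_card_choose_two, Fintype.card_fin]
  rw [hcard F, ← wsum (⊤ : SimpleGraph (Fin n)).edgeFinset F.edgeFinset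
    (SimpleGraph.edgeFinset_subset_edgeFinset.mpr le_top) p, ← Finset.sum_filter]
  apply Finset.sum_bij (fun G _ => G.edgeFinset)
  · intro G hG
    simp only [Finset.mem_filter, Finset.mem_univ, true_and] at hG
    simp only [Finset.mem_filter, Finset.mem_powerset]
    exact ⟨SimpleGraph.edgeFinset_subset_edgeFinset.mpr le_top,
      SimpleGraph.edgeFinset_subset_edgeFinset.mpr hG⟩
  · intro G _ G' _ h
    exact SimpleGraph.edgeFinset_inj.mp h
  · intro t ht
    simp only [Finset.mem_filter, Finset.mem_powerset] at ht
    have he : (SimpleGraph.fromEdgeSet (t : Set (Sym2 (Fin n)))).edgeFinset = t := by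
      ext e
      rw [SimpleGraph.mem_edgeFinset, SimpleGraph.edgeSet_fromEdgeSet]
      constructor
      · exact fun h => h.1
      · intro h
        refine ⟨h, fun hd => ?_⟩
        have := SimpleGraph.mem_edgeFinset.mp (ht.1 h)
        exact SimpleGraph.not_isDiag_of_mem_edgeSet _ this hd
    refine ⟨SimpleGraph.fromEdgeSet (t : Set (Sym2 (Fin n))), ?_, by convert he⟩
    simp only [Finset.mem_filter, Finset.mem_univ, true_and]
    rw [← SimpleGraph.edgeFinset_subset_edgeFinset]
    convert ht.2
  · intro G _
    rw [hcard, hU]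

theorem gnp_le_one (n : ℕ) (p : ℝ) (h0 : 0 ≤ p) (h1 : p ≤ 1) (A : Set (SimpleGraph (Fin n))) :
    gnpProb n p A ≤ 1 := by
  classical
  have h := gnp_contains n p ⊥
  have hb : edgeCard (⊥ : SimpleGraph (Fin n)) = 0 := by simp [edgeCard]
  rw [hb, pow_zero] at h
  refine le_trans ?_ h.le
  rw [gnpProb]
  apply Finset.sum_le_sum
  intro G _
  have : 0 ≤ p ^ edgeCard G * (1 - p) ^ (n.choose 2 - edgeCard G) :=
    mul_nonneg (pow_nonneg h0 _) (pow_nonneg (by linarith) _)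
  rw [if_pos (bot_le : ⊥ ≤ G)]
  split_ifs
  · exact le_refl _
  · exact this

theorem gnp_union {ι : Type*} (n : ℕ) (p q : ℝ) (h0 : 0 ≤ p) (hpq : p ≤ q) (hq : q ≤ 1)
    (A : Set (SimpleGraph (Fin n))) (I : Finset ι) (fam : ι → Finset (SimpleGraph (Fin n)))
    (m : ι → ℕ) (hm : ∀ i ∈ I, ∀ F ∈ fam i, m i ≤ edgeCard F)
    (hA : ∀ G, G ∉ A → ∃ i ∈ I, ∃ F ∈ fam i, F ≤ G) :
    1 - ∑ i ∈ I, ((fam i).card : ℝ) * q ^ m i ≤ gnpProb n p A := by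
  classical
  have h1 : p ≤ 1 := hpq.trans hq
  have hw : ∀ G : SimpleGraph (Fin n),
      0 ≤ p ^ edgeCard G * (1 - p) ^ (n.choose 2 - edgeCard G) := fun G =>
    mul_nonneg (pow_nonneg h0 _) (pow_nonneg (by linarith) _)
  have h := gnp_contains n p ⊥
  have hb : edgeCard (⊥ : SimpleGraph (Fin n)) = 0 := by simp [edgeCard]
  rw [hb, pow_zero] at h
  have key : (1 : ℝ) ≤ gnpProb n p A + ∑ i ∈ I, ∑ F ∈ fam i, p ^ edgeCard F := by
    have e0 : ∑ i ∈ I, ∑ F ∈ fam i, p ^ edgeCard F = ∑ i ∈ I, ∑ F ∈ fam i,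
        ∑ G : SimpleGraph (Fin n), (if F ≤ G then
        p ^ edgeCard G * (1 - p) ^ (n.choose 2 - edgeCard G) else 0) :=
      Finset.sum_congr rfl fun i _ => Finset.sum_congr rfl fun F _ => (gnp_contains n p F).symm
    have e : ∑ i ∈ I, ∑ F ∈ fam i, ∑ G : SimpleGraph (Fin n), (if F ≤ G then
        p ^ edgeCard G * (1 - p) ^ (n.choose 2 - edgeCard G) else 0) =
        ∑ G : SimpleGraph (Fin n), ∑ i ∈ I, ∑ F ∈ fam i, (if F ≤ G then
        p ^ edgeCard G * (1 - p) ^ (n.choose 2 - edgeCard G) else 0) := by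
      conv_rhs => rw [Finset.sum_comm]
      apply Finset.sum_congr rfl
      intro i _
      rw [Finset.sum_comm]
    rw [e0, e, gnpProb, ← Finset.sum_add_distrib]
    refine h.ge.trans ?_
    apply Finset.sum_le_sum
    intro G _
    rw [if_pos (bot_le : ⊥ ≤ G)]
    have hnn : ∀ i ∈ I, 0 ≤ ∑ F ∈ fam i, (if F ≤ G then
        p ^ edgeCard G * (1 - p) ^ (n.choose 2 - edgeCard G) else 0) := by
      intro i _
      apply Finset.sum_nonneg
      intro F _
      split_ifs
      · exact hw G
      · exact le_refl _
    by_cases hG : G ∈ A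
    · rw [if_pos hG]
      have := Finset.sum_nonneg hnn
      linarith
    · rw [if_neg hG, zero_add]
      obtain ⟨i, hi, F, hF, hFG⟩ := hA G hG
      refine le_trans ?_ (Finset.single_le_sum hnn hi)
      refine le_trans ?_ (Finset.single_le_sum (f := fun F => if F ≤ G then
        p ^ edgeCard G * (1 - p) ^ (n.choose 2 - edgeCard G) else 0) ?_ hF)
      · simp only [if_pos hFG]
        exact le_refl _
      · intro F _
        split_ifs
        · exact hw G
        · exact le_refl _
  have hle : ∑ i ∈ I, ∑ F ∈ fam i, p ^ edgeCard F ≤ ∑ i ∈ I, ((fam i).card : ℝ) * q ^ m i := by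
    apply Finset.sum_le_sum
    intro i hi
    rw [← nsmul_eq_mul]
    apply Finset.sum_le_card_nsmul
    intro F hF
    calc p ^ edgeCard F ≤ q ^ edgeCard F := pow_le_pow_left₀ h0 hpq _
      _ ≤ q ^ m i := pow_le_pow_of_le_one (h0.trans hpq) hq (hm i hi F hF)
  linarith

end Prob

section Asymp
open Filter

theorem term_sum (n ℓ M R : ℕ) (q δ c : ℝ) (hq0 : 0 < q) (hq1 : q ≤ 1) (hδ0 : 0 < δ)
    (hδ1 : δ ≤ 1) (hqc : (n : ℝ) * q ^ 3 = c ^ 3)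
    (hB : 4 * (4 + δ) * (((M + 1 : ℕ) : ℝ) / δ) ^ 6 * q ≤ 1 / 2) :
    ∑ r ∈ Finset.range R, ((cplx (Fin n) ℓ (2 * M + r) M).card : ℝ) *
      q ^ (M + (2 * M + r - ℓ)) ≤ 2 * (n * (8 * (4 + δ) ^ 2 * c ^ 3) ^ M / q ^ ℓ) := by
  set b : ℝ := 4 * (4 + δ) * (((M + 1 : ℕ) : ℝ) / δ) ^ 6 * q with hb
  have hb0 : 0 ≤ b := by positivity
  have hc0 : 0 ≤ c ^ 3 := by rw [← hqc]; positivity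
  have hT : 0 ≤ (n : ℝ) * (8 * (4 + δ) ^ 2 * c ^ 3) ^ M / q ^ ℓ := by positivity
  have h1 : ∀ r ∈ Finset.range R, ((cplx (Fin n) ℓ (2 * M + r) M).card : ℝ) *
      q ^ (M + (2 * M + r - ℓ)) ≤
      n * (8 * (4 + δ) ^ 2 * c ^ 3) ^ M / q ^ ℓ * (1 / 2) ^ r := by
    intro r _
    have hcard := cplx_card (V := Fin n) ℓ (2 * M + r) M δ hδ0 hδ1
    rw [Fintype.card_fin, Nat.add_sub_cancel_left] at hcard
    have hpow : q ^ (2 * M + r - ℓ) ≤ q ^ (2 * M + r) / q ^ ℓ := by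
      rw [le_div_iff₀ (by positivity), ← pow_add]
      exact pow_le_pow_of_le_one hq0.le hq1 (by omega)
    calc ((cplx (Fin n) ℓ (2 * M + r) M).card : ℝ) * q ^ (M + (2 * M + r - ℓ))
        ≤ (4 ^ (2 * M + r) * (n : ℝ) ^ (M + 1) * ((4 + δ) ^ (2 * M + r) / 2 ^ M *
          (((M + 1 : ℕ) : ℝ) / δ) ^ (6 * r))) * (q ^ M * (q ^ (2 * M + r) / q ^ ℓ)) := by
          rw [pow_add q M]
          gcongr
      _ = n * (8 * (4 + δ) ^ 2 * (n * q ^ 3)) ^ M / q ^ ℓ * b ^ r := by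
          rw [hb]
          have e8 : (8 : ℝ) ^ M = 4 ^ (2 * M) / 2 ^ M := by
            rw [pow_mul, ← div_pow]; norm_num
          simp only [mul_pow, e8]
          rw [pow_mul _ 6 r, pow_add, pow_add, pow_add q, pow_succ (n : ℝ),
            ← pow_mul q 3 M, ← pow_mul (4 + δ) 2 M]
          have : q ^ (3 * M) = q ^ M * q ^ (2 * M) := by rw [← pow_add]; congr 1; ring
          rw [this, pow_add (4 + δ)]
          field_simp
      _ ≤ _ := by
          rw [hqc]
          gcongr
  calc _ ≤ ∑ r ∈ Finset.range R, n * (8 * (4 + δ) ^ 2 * c ^ 3) ^ M / q ^ ℓ * (1 / 2) ^ r :=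
        Finset.sum_le_sum h1
    _ = (n * (8 * (4 + δ) ^ 2 * c ^ 3) ^ M / q ^ ℓ) * ∑ r ∈ Finset.range R, (1 / 2 : ℝ) ^ r := by
        rw [Finset.mul_sum]
    _ ≤ (n * (8 * (4 + δ) ^ 2 * c ^ 3) ^ M / q ^ ℓ) * 2 := by
        gcongr
        exact sum_geometric_two_le R
    _ = _ := by ring

theorem term_small (n ℓ M : ℕ) (q ρ c K : ℝ) (hn : 1 ≤ n) (hq0 : 0 < q) (hρ0 : 0 < ρ)
    (hρ1 : ρ < 1) (hK : K * Real.log ρ ≤ -1) (hc : 0 < c) (hqc : (n : ℝ) * q ^ 3 = c ^ 3)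
    (hqn : 1 ≤ n * q) (hℓ : 3 ≤ ℓ) (hM : K * ℓ * Real.log n ≤ ((M + 1 : ℕ) : ℝ)) :
    2 * (n * ρ ^ M / q ^ ℓ) ≤ 2 / (ρ * c ^ 3) / n := by
  have hn0 : (0 : ℝ) < n := by exact_mod_cast hn
  have hlogn : 0 ≤ Real.log n := Real.log_nonneg (by exact_mod_cast hn)
  have hlogρ : Real.log ρ < 0 := Real.log_neg hρ0 hρ1
  have h1 : ρ ^ (M + 1) ≤ ((n : ℝ) ^ ℓ)⁻¹ := by
    rw [← Real.log_le_log_iff (by positivity) (by positivity), Real.log_inv, Real.log_pow,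
      Real.log_pow]
    calc ((M + 1 : ℕ) : ℝ) * Real.log ρ ≤ (K * ℓ * Real.log n) * Real.log ρ :=
          mul_le_mul_of_nonpos_right hM hlogρ.le
      _ = (K * Real.log ρ) * (ℓ * Real.log n) := by ring
      _ ≤ (-1) * (ℓ * Real.log n) := by gcongr
      _ = _ := by ring
  have h2 : ρ ^ M ≤ ((n : ℝ) ^ ℓ)⁻¹ / ρ := by
    rw [le_div_iff₀ hρ0, ← pow_succ]; exact h1
  have h3 : (n * q) ^ 3 ≤ (n * q) ^ ℓ := pow_le_pow_right₀ hqn hℓ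
  calc 2 * (n * ρ ^ M / q ^ ℓ) ≤ 2 * (n * (((n : ℝ) ^ ℓ)⁻¹ / ρ) / q ^ ℓ) := by gcongr
    _ = 2 * n / ρ / (n * q) ^ ℓ := by rw [mul_pow]; field_simp
    _ ≤ 2 * n / ρ / (n * q) ^ 3 := by gcongr
    _ = 2 * n / ρ / (n ^ 2 * c ^ 3) := by rw [← hqc]; ring
    _ = _ := by field_simp

theorem choose_delta (c K : ℝ) (hc0 : 0 < c) (hK : K * Real.log (128 * c ^ 3) < -1) :
    ∃ δ : ℝ, 0 < δ ∧ δ ≤ 1 ∧ K * Real.log (8 * (4 + δ) ^ 2 * c ^ 3) ≤ -1 := by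
  have hcont : ContinuousAt (fun δ : ℝ => K * Real.log (8 * (4 + δ) ^ 2 * c ^ 3)) 0 := by
    apply ContinuousAt.mul continuousAt_const
    apply ContinuousAt.log
    · fun_prop
    · positivity
  have h0 : K * Real.log (8 * (4 + (0 : ℝ)) ^ 2 * c ^ 3) < -1 := by
    convert hK using 4
    norm_num
  have h1 := hcont.eventually (gt_mem_nhds h0)
  have h2 : ∀ᶠ δ in nhdsWithin (0 : ℝ) (Set.Ioi 0),
      K * Real.log (8 * (4 + δ) ^ 2 * c ^ 3) < -1 := nhdsWithin_le_nhds h1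
  have h3 : ∀ᶠ δ in nhdsWithin (0 : ℝ) (Set.Ioi 0), δ ∈ Set.Ioc (0 : ℝ) 1 :=
    Ioc_mem_nhdsGT one_pos
  obtain ⟨δ, ha, hb⟩ := (h2.and h3).exists
  exact ⟨δ, hb.1, hb.2, ha.le⟩

/-- powers beat logarithms -/
theorem tendsto_pow_log (s : ℝ) (hs : s < 0) (k : ℕ) :
    Tendsto (fun n : ℕ => (n : ℝ) ^ s * Real.log n ^ k) atTop (nhds 0) := by
  have h := ((isLittleO_log_rpow_rpow_atTop (k : ℝ) (neg_pos.mpr hs)).tendsto_div_nhds_zero).comp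
    tendsto_natCast_atTop_atTop
  refine h.congr' ?_
  filter_upwards [eventually_ge_atTop 1] with n hn
  have hn0 : (0 : ℝ) < n := by exact_mod_cast hn
  simp only [Function.comp_apply]
  rw [Real.rpow_natCast, Real.rpow_neg hn0.le, div_inv_eq_mul, mul_comm]

end Asymp

/-- For `p < c n^{-1/3}` with `c ∈ (0, 2^{-7/3})`, constants
`K₂ > K₁ > −1/ln(2⁷c³)` and `0 < ε < 1/18`, w.h.p. for every `3 ≤ ℓ ≤ n^ε` there are no
`H, C ⊆ G` with `C` an `ℓ`-cycle, `|V(H)| ∈ [K₁ ℓ ln n, K₂ ℓ ln n]` and `H → C` via a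
nice activation process in `G`. -/
theorem statement13 (c : ℝ) (hc0 : 0 < c) (hc : c < (2 : ℝ) ^ (-(7 : ℝ) / 3))
    (K₁ K₂ ε : ℝ)
    (hK₁ : -1 / Real.log ((2 : ℝ) ^ (7 : ℕ) * c ^ (3 : ℕ)) < K₁) (hK : K₁ < K₂)
    (hε0 : 0 < ε) (hε : ε < 1 / 18)
    (p : ℕ → ℝ) (hp0 : ∀ n, 0 ≤ p n)
    (hp : ∀ n : ℕ, 1 ≤ n → p n < c * (n : ℝ) ^ (-(1 : ℝ) / 3)) :
    Filter.Tendsto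
      (fun n => gnpProb n (p n)
        {G | ∀ ℓ : ℕ, 3 ≤ ℓ → (ℓ : ℝ) ≤ (n : ℝ) ^ ε →
          ¬ ∃ (H : SimpleGraph (Fin n)) (steps : List (Fin n × Fin n × Fin n))
              (x : Fin n) (wk : G.Walk x x),
            wk.IsCycle ∧ wk.length = ℓ ∧
            K₁ * ℓ * Real.log n ≤ (supportCard H : ℝ) ∧
            (supportCard H : ℝ) ≤ K₂ * ℓ * Real.log n ∧
            NiceActivation G H (walkEdgeGraph wk) steps})
      Filter.atTop (nhds 1) := by
  classical
  -- constants
  have hc3 : 128 * c ^ 3 < 1 := by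
    have h1 : c ^ 3 < ((2 : ℝ) ^ (-(7 : ℝ) / 3)) ^ 3 := pow_lt_pow_left₀ hc hc0.le (by norm_num)
    have h2 : ((2 : ℝ) ^ (-(7 : ℝ) / 3)) ^ 3 = 1 / 128 := by
      rw [← Real.rpow_natCast, ← Real.rpow_mul (by norm_num)]
      rw [show (-(7 : ℝ) / 3 * ((3 : ℕ) : ℝ)) = -((7 : ℕ) : ℝ) by norm_num,
        Real.rpow_neg (by norm_num), Real.rpow_natCast]
      norm_num
    linarith
  have hlog : Real.log (128 * c ^ 3) < 0 := Real.log_neg (by positivity) hc3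
  have hK₁' : -1 / Real.log (128 * c ^ 3) < K₁ := by
    rw [show (2 : ℝ) ^ 7 = 128 by norm_num] at hK₁
    exact hK₁
  have hK₁0 : 0 < K₁ := lt_trans (div_pos_of_neg_of_neg (by norm_num) hlog) hK₁'
  have hK₂0 : 0 < K₂ := hK₁0.trans hK
  have hKlog : K₁ * Real.log (128 * c ^ 3) < -1 := by
    rwa [div_lt_iff_of_neg hlog] at hK₁'
  obtain ⟨δ, hδ0, hδ1, hδ⟩ := choose_delta c K₁ hc0 hKlog
  set ρ : ℝ := 8 * (4 + δ) ^ 2 * c ^ 3 with hρ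
  have hρ0 : 0 < ρ := by positivity
  have hρ1 : ρ < 1 := by
    by_contra hge
    have : 0 ≤ K₁ * Real.log ρ := mul_nonneg hK₁0.le (Real.log_nonneg (not_lt.mp hge))
    linarith
  set D : ℝ := 2 / (ρ * c ^ 3) with hD
  have hD0 : 0 < D := by positivity
  -- eventual facts
  have ev1 : ∀ᶠ n : ℕ in Filter.atTop, c * (n : ℝ) ^ (-(1 : ℝ) / 3) ≤ 1 := by
    have h := (tendsto_pow_log (-(1 : ℝ) / 3) (by norm_num) 0).const_mul c
    simp only [pow_zero, mul_one, mul_zero] at h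
    exact h.eventually_le_const (by norm_num)
  have ev2 : ∀ᶠ n : ℕ in Filter.atTop, 1 ≤ (n : ℝ) * (c * (n : ℝ) ^ (-(1 : ℝ) / 3)) := by
    have h := ((tendsto_rpow_atTop (show (0 : ℝ) < 2 / 3 by norm_num)).comp
      tendsto_natCast_atTop_atTop (α := ℕ)).const_mul_atTop hc0
    filter_upwards [h.eventually_ge_atTop 1, Filter.eventually_ge_atTop 1] with n hn hn1
    have hn0 : (0 : ℝ) < n := by exact_mod_cast hn1
    have e : (n : ℝ) ^ (2 / 3 : ℝ) = n * (n : ℝ) ^ (-(1 : ℝ) / 3) := by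
      rw [← Real.rpow_one_add' hn0.le (by norm_num)]
      norm_num
    simp only [Function.comp_apply, e] at hn
    linarith
  have ev3 : ∀ᶠ n : ℕ in Filter.atTop, 4 * (4 + δ) * (K₂ * (n : ℝ) ^ ε * Real.log n / δ) ^ 6 *
      (c * (n : ℝ) ^ (-(1 : ℝ) / 3)) ≤ 1 / 2 := by
    have h := (tendsto_pow_log (ε * 6 + -(1 : ℝ) / 3) (by linarith) 6).const_mul
      (4 * (4 + δ) * (K₂ / δ) ^ 6 * c)
    rw [mul_zero] at h
    filter_upwards [h.eventually_le_const (show (0 : ℝ) < 1 / 2 by norm_num),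
      Filter.eventually_ge_atTop 1] with n hn hn1
    have hn0 : (0 : ℝ) < n := by exact_mod_cast hn1
    refine le_trans (le_of_eq ?_) hn
    rw [Real.rpow_add hn0, Real.rpow_mul hn0.le]
    have : ((n : ℝ) ^ ε) ^ (6 : ℝ) = ((n : ℝ) ^ ε) ^ 6 := by
      rw [← Real.rpow_natCast]; norm_num
    rw [this]
    ring
  have lim : Filter.Tendsto (fun n : ℕ => 1 - (2 * K₂ * D * ((n : ℝ) ^ (2 * ε - 1) *
      Real.log n ^ 1) + 2 * D * ((n : ℝ) ^ (ε - 1) * Real.log n ^ 0))) Filter.atTop (nhds 1) := by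
    have h1 := (tendsto_pow_log (2 * ε - 1) (by linarith) 1).const_mul (2 * K₂ * D)
    have h2 := (tendsto_pow_log (ε - 1) (by linarith) 0).const_mul (2 * D)
    have h3 := (h1.add h2).const_sub 1
    simpa using h3
  refine tendsto_of_tendsto_of_tendsto_of_le_of_le' lim tendsto_const_nhds ?_ ?_
  swap
  · filter_upwards [ev1, Filter.eventually_ge_atTop 1] with n h1 hn
    exact gnp_le_one n (p n) (hp0 n) ((hp n hn).le.trans h1) _
  filter_upwards [ev1, ev2, ev3, Filter.eventually_ge_atTop 1] with n h1 h2 h3 hn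
  have hn0 : (0 : ℝ) < n := by exact_mod_cast hn
  have hn1 : (1 : ℝ) ≤ n := by exact_mod_cast hn
  have hlogn : 0 ≤ Real.log n := Real.log_nonneg hn1
  have hpn := (hp n hn).le
  have hqc : (n : ℝ) * (c * (n : ℝ) ^ (-(1 : ℝ) / 3)) ^ 3 = c ^ 3 := by
    rw [mul_pow, ← Real.rpow_natCast ((n : ℝ) ^ (-(1 : ℝ) / 3)), ← Real.rpow_mul hn0.le]
    rw [show (-(1 : ℝ) / 3 * ((3 : ℕ) : ℝ)) = -1 by norm_num, Real.rpow_neg_one]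
    field_simp
  have hq0 : 0 < c * (n : ℝ) ^ (-(1 : ℝ) / 3) := by positivity
  generalize c * (n : ℝ) ^ (-(1 : ℝ) / 3) = q at h1 h2 h3 hpn hqc hq0
  set B : ℝ := K₂ * (n : ℝ) ^ ε * Real.log n with hB
  have hB0 : 0 ≤ B := by positivity
  let J : Finset (ℕ × ℕ) :=
    ((Finset.range (⌊(n : ℝ) ^ ε⌋₊ + 1)) ×ˢ (Finset.range (⌊B⌋₊ + 1))).filter fun a =>
      3 ≤ a.1 ∧ K₁ * a.1 * Real.log n ≤ ((a.2 + 1 : ℕ) : ℝ) ∧ ((a.2 + 1 : ℕ) : ℝ) ≤ B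
  let I : Finset ((ℕ × ℕ) × ℕ) := J ×ˢ Finset.range (2 * n ^ 2 + 1)
  have hunion := gnp_union n (p n) q (hp0 n) hpn h1
    {G | ∀ ℓ : ℕ, 3 ≤ ℓ → (ℓ : ℝ) ≤ (n : ℝ) ^ ε →
          ¬ ∃ (H : SimpleGraph (Fin n)) (steps : List (Fin n × Fin n × Fin n))
              (x : Fin n) (wk : G.Walk x x),
            wk.IsCycle ∧ wk.length = ℓ ∧
            K₁ * ℓ * Real.log n ≤ (supportCard H : ℝ) ∧
            (supportCard H : ℝ) ≤ K₂ * ℓ * Real.log n ∧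
            NiceActivation G H (walkEdgeGraph wk) steps}
    I (fun i => cplx (Fin n) i.1.1 (2 * i.1.2 + i.2) i.1.2)
    (fun i => i.1.2 + (2 * i.1.2 + i.2 - i.1.1)) ?_ ?_
  rotate_left
  · intro i _ F hF
    exact (Finset.mem_filter.mp hF).2.1
  · intro G hG
    simp only [Set.mem_ofPred_eq, not_forall, not_not] at hG
    obtain ⟨ℓ, hℓ3, hℓn, H, steps, x, wk, hcyc, rfl, hv1, hv2, hact⟩ := hG
    obtain ⟨M, r, hM, hr, hr2, F, hF, hFG⟩ := cplx_exists wk hcyc hact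
    rw [hM] at hv1 hv2
    have hMB : ((M + 1 : ℕ) : ℝ) ≤ B := by
      refine hv2.trans ?_
      rw [hB]
      gcongr
    refine ⟨((wk.length, M), r), ?_, F, hF, hFG⟩
    simp only [I, J, Finset.mem_product, Finset.mem_filter, Finset.mem_range, Nat.lt_succ_iff]
    refine ⟨⟨⟨Nat.le_floor hℓn, Nat.le_floor ?_⟩, hℓ3, hv1, hMB⟩, ?_⟩
    · push_cast at hMB
      linarith
    · simpa using hr2
  refine le_trans ?_ hunion
  have hsum : ∑ i ∈ I, ((cplx (Fin n) i.1.1 (2 * i.1.2 + i.2) i.1.2).card : ℝ) *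
      q ^ (i.1.2 + (2 * i.1.2 + i.2 - i.1.1)) ≤ (J.card : ℝ) * (D / n) := by
    simp only [I]
    rw [Finset.sum_product, ← nsmul_eq_mul]
    apply Finset.sum_le_card_nsmul
    intro a ha
    have ha := (Finset.mem_filter.mp ha).2
    refine (term_sum n a.1 a.2 _ q δ c hq0 h1 hδ0 hδ1 hqc ?_).trans
      (term_small n a.1 a.2 q ρ c K₁ hn hq0 hρ0 hρ1 hδ hc0 hqc h2 ha.1 ha.2.1)
    refine le_trans ?_ h3
    have := ha.2.2
    gcongr
  have hJ : (J.card : ℝ) ≤ (2 * (n : ℝ) ^ ε) * (B + 1) := by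
    have e1 : (J.card : ℝ) ≤ (((⌊(n : ℝ) ^ ε⌋₊ + 1) * (⌊B⌋₊ + 1) : ℕ) : ℝ) := by
      have := Finset.card_filter_le
        ((Finset.range (⌊(n : ℝ) ^ ε⌋₊ + 1)) ×ˢ (Finset.range (⌊B⌋₊ + 1))) fun a =>
        3 ≤ a.1 ∧ K₁ * a.1 * Real.log n ≤ ((a.2 + 1 : ℕ) : ℝ) ∧ ((a.2 + 1 : ℕ) : ℝ) ≤ B
      rw [Finset.card_product, Finset.card_range, Finset.card_range] at this
      exact_mod_cast this
    refine e1.trans ?_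
    push_cast
    have f1 : (⌊(n : ℝ) ^ ε⌋₊ : ℝ) ≤ (n : ℝ) ^ ε := Nat.floor_le (by positivity)
    have f2 : (⌊B⌋₊ : ℝ) ≤ B := Nat.floor_le hB0
    have f3 : 1 ≤ (n : ℝ) ^ ε := Real.one_le_rpow hn1 hε0.le
    gcongr
    linarith
  have hfin : (J.card : ℝ) * (D / n) ≤ 2 * K₂ * D * ((n : ℝ) ^ (2 * ε - 1) *
      Real.log n ^ 1) + 2 * D * ((n : ℝ) ^ (ε - 1) * Real.log n ^ 0) := by
    calc (J.card : ℝ) * (D / n) ≤ (2 * (n : ℝ) ^ ε) * (B + 1) * (D / n) := by gcongr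
      _ = _ := by
        rw [hB, Real.rpow_sub hn0, Real.rpow_sub hn0, Real.rpow_one, two_mul ε,
          Real.rpow_add hn0]
        field_simp
        try ring
  linarith

end WSat
end

section
/- Suppose A is an activation process of a cycle C such that C is contractible in K(A). Then there is a nice subprocess A* ⊆ A activating C, starting from a connected graph, and such that C is contractible in K(A*). -/
namespace WSat

variable {V : Type} [Fintype V] [DecidableEq V]

/-- `(H'; steps')` is a subprocess of the activation process `(H; steps)`: its triangles
form a subsequence of the triangles of `(H; steps)`, each activating the same edge, and the
initial graph `H'` lies in `K⁽¹⁾(A)`. -/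
def Subprocess (H' : SimpleGraph V) (steps' : List (V × V × V))
    (H : SimpleGraph V) (steps : List (V × V × V)) : Prop :=
  IsValidProcess H' steps' ∧ H' ≤ afterGraph H steps ∧ steps'.Sublist steps

/-- A graph, viewed on its set of non-isolated vertices, is connected. -/
def EdgeConnected (G : SimpleGraph V) : Prop :=
  G.support.Nonempty ∧ ∀ u ∈ G.support, ∀ v ∈ G.support, G.Reachable u v

/-- Elementary homotopy moves on closed walks (recorded as lists of vertices) in a
2-dimensional complex with 1-skeleton `G` and triangular faces `F`: inserting (or, by
symmetry, deleting) a backtrack, and replacing one side of a triangular face by the other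
two sides. -/
inductive HStep (G : SimpleGraph V) (F : V → V → V → Prop) : List V → List V → Prop
  | back (l₁ l₂ : List V) (a b : V) (h : G.Adj a b) :
      HStep G F (l₁ ++ a :: l₂) (l₁ ++ a :: b :: a :: l₂)
  | tri (l₁ l₂ : List V) (a b c : V) (h : F a b c) :
      HStep G F (l₁ ++ a :: b :: l₂) (l₁ ++ a :: c :: b :: l₂)

/-- A closed walk (given by its list of vertices) based at `x` is null-homotopic if it can
be transformed into the constant walk at `x` by elementary homotopy moves. -/
def NullHomotopic (G : SimpleGraph V) (F : V → V → V → Prop) (l : List V) (x : V) : Prop :=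
  Relation.EqvGen (HStep G F) l [x]

/-- The triangular faces of the activation complex `K(A)` of a process with steps
`steps`. -/
def facesOf (steps : List (V × V × V)) (a b c : V) : Prop :=
  ∃ st ∈ steps, ({a, b, c} : Set V) = {st.1, st.2.1, st.2.2}

/-- The graph `C` is a cycle which is contractible in the 2-dimensional complex with
1-skeleton `skel` and triangular faces `F`. -/
def CycContractible (skel : SimpleGraph V) (F : V → V → V → Prop) (C : SimpleGraph V) : Prop :=
  ∃ (x : V) (w : skel.Walk x x), w.IsCycle ∧ C.edgeSet = {e | e ∈ w.edges} ∧
    NullHomotopic skel F w.support x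

set_option linter.unusedSectionVars false
set_option linter.unusedSimpArgs false

/-! ### Group labellings -/

/-- Product of a labelling along a list of vertices. -/
def prodAlong {Γ : Type} [Group Γ] (g : V → V → Γ) : List V → Γ
  | [] => 1
  | [_] => 1
  | a :: b :: l => g a b * prodAlong g (b :: l)

theorem prodAlong_append {Γ : Type} [Group Γ] (g : V → V → Γ) (l₁ : List V) (a : V) (l₂ : List V) :
    prodAlong g (l₁ ++ a :: l₂) = prodAlong g (l₁ ++ [a]) * prodAlong g (a :: l₂) := by
  induction l₁ with
  | nil => simp [prodAlong]
  | cons u l ih =>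
    cases l with
    | nil => simp [prodAlong]
    | cons v l =>
      simp only [List.cons_append, prodAlong] at ih ⊢
      rw [ih, mul_assoc]

theorem prodAlong_congr {Γ : Type} [Group Γ] (g g' : V → V → Γ) (l : List V)
    (h : l.IsChain (fun u v => g u v = g' u v)) : prodAlong g l = prodAlong g' l := by
  induction l with
  | nil => rfl
  | cons u l ih =>
    cases l with
    | nil => rfl
    | cons v l =>
      rw [List.isChain_cons_cons] at h
      simp only [prodAlong]
      rw [ih h.2, h.1]

/-- Every compatible labelling has trivial product along `l`. -/
def GTriv (G : SimpleGraph V) (F : V → V → V → Prop) (l : List V) : Prop :=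
  ∀ (Γ : Type) [Group Γ] (g : V → V → Γ), (∀ a b, G.Adj a b → g a b * g b a = 1) →
    (∀ a b c, F a b c → g a b = g a c * g c b) → prodAlong g l = 1

theorem gtriv_of_null (G : SimpleGraph V) (F : V → V → V → Prop) (l : List V) (x : V)
    (h : NullHomotopic G F l x) : GTriv G F l := by
  intro Γ _ g hg hf
  have key : ∀ l l', Relation.EqvGen (HStep G F) l l' → prodAlong g l = prodAlong g l' := by
    intro l l' h
    induction h with
    | rel l l' h =>
      cases h with
      | back l₁ l₂ a b h =>
        rw [prodAlong_append, prodAlong_append g l₁ a (b :: a :: l₂)]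
        simp only [prodAlong]
        rw [← mul_assoc (g a b), hg a b h, one_mul]
      | tri l₁ l₂ a b c h =>
        rw [prodAlong_append, prodAlong_append g l₁ a (c :: b :: l₂)]
        simp only [prodAlong]
        rw [← mul_assoc (g a c), hf a b c h]
    | refl => rfl
    | symm _ _ _ ih => exact ih.symm
    | trans _ _ _ _ _ ih1 ih2 => exact ih1.trans ih2
  rw [key _ _ h]; rfl

/-! ### From labellings back to homotopies -/

/-- Homotopy classes of lists. -/
def hsetoid (G : SimpleGraph V) (F : V → V → V → Prop) : Setoid (List V) :=
  Relation.EqvGen.setoid (HStep G F)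

theorem eqv_cons (G : SimpleGraph V) (F : V → V → V → Prop) (u : V) (l l' : List V)
    (h : Relation.EqvGen (HStep G F) l l') : Relation.EqvGen (HStep G F) (u :: l) (u :: l') := by
  induction h with
  | rel l l' h =>
    cases h with
    | back l₁ l₂ a b h => exact .rel _ _ (HStep.back (u :: l₁) l₂ a b h)
    | tri l₁ l₂ a b c h => exact .rel _ _ (HStep.tri (u :: l₁) l₂ a b c h)
  | refl => exact .refl _
  | symm _ _ _ ih => exact ih.symm
  | trans _ _ _ _ _ ih1 ih2 => exact ih1.trans _ _ _ ih2

theorem eqv_head (G : SimpleGraph V) (F : V → V → V → Prop) (l l' : List V)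
    (h : Relation.EqvGen (HStep G F) l l') : l.head? = l'.head? := by
  induction h with
  | rel l l' h =>
    cases h with
    | back l₁ l₂ a b h => cases l₁ <;> simp
    | tri l₁ l₂ a b c h => cases l₁ <;> simp
  | refl => rfl
  | symm _ _ _ ih => exact ih.symm
  | trans _ _ _ _ _ ih1 ih2 => exact ih1.trans ih2

/-- Head vertex of a class. -/
def qhead (G : SimpleGraph V) (F : V → V → V → Prop) : Quotient (hsetoid G F) → Option V :=
  Quotient.lift List.head? (eqv_head G F)

/-- Prepending a vertex to a class. -/
def qcons (G : SimpleGraph V) (F : V → V → V → Prop) (u : V) :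
    Quotient (hsetoid G F) → Quotient (hsetoid G F) :=
  Quotient.map (fun l => u :: l) (eqv_cons G F u)

theorem qhead_qcons (G : SimpleGraph V) (F : V → V → V → Prop) (u : V)
    (q : Quotient (hsetoid G F)) : qhead G F (qcons G F u q) = some u := by
  induction q using Quotient.inductionOn with
  | h l => rfl

theorem qcons_qcons (G : SimpleGraph V) (F : V → V → V → Prop) (u v : V) (h : G.Adj u v)
    (q : Quotient (hsetoid G F)) (hq : qhead G F q = some v) :
    qcons G F v (qcons G F u q) = q := by
  induction q using Quotient.inductionOn with
  | h l =>
    cases l with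
    | nil => exact absurd hq (by change ¬ (none = some _); simp)
    | cons w l =>
      have : w = v := Option.some.inj hq
      subst this
      exact Quotient.sound (Relation.EqvGen.symm _ _ (.rel _ _ (HStep.back [] l w u h.symm)))

theorem qcons_tri (G : SimpleGraph V) (F : V → V → V → Prop) (a b c : V) (h : F a b c)
    (q : Quotient (hsetoid G F)) (hq : qhead G F q = some b) :
    qcons G F a q = qcons G F a (qcons G F c q) := by
  induction q using Quotient.inductionOn with
  | h l =>
    cases l with
    | nil => exact absurd hq (by change ¬ (none = some _); simp)
    | cons w l =>
      have : w = b := Option.some.inj hq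
      subst this
      exact Quotient.sound (.rel _ _ (HStep.tri [] l a w c h))

/-- Classes starting at `v`. -/
def Fib (G : SimpleGraph V) (F : V → V → V → Prop) (v : V) : Type :=
  {q : Quotient (hsetoid G F) // qhead G F q = some v}

/-- Transport between fibres along an edge. -/
def tau (G : SimpleGraph V) (F : V → V → V → Prop) (u v : V) (h : G.Adj u v) :
    Fib G F v ≃ Fib G F u where
  toFun q := ⟨qcons G F u q.1, qhead_qcons G F u q.1⟩
  invFun q := ⟨qcons G F v q.1, qhead_qcons G F v q.1⟩
  left_inv q := Subtype.ext (qcons_qcons G F u v h q.1 q.2)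
  right_inv q := Subtype.ext (qcons_qcons G F v u h.symm q.1 q.2)

theorem fib_equiv (G : SimpleGraph V) (F : V → V → V → Prop) (x u : V) (h : G.Reachable x u) :
    Nonempty (Fib G F x ≃ Fib G F u) := by
  obtain ⟨p⟩ := h
  induction p with
  | nil => exact ⟨Equiv.refl _⟩
  | cons h p ih => exact ih.map (fun e => (tau G F _ _ h).symm.trans e)

theorem null_of_gtriv (G : SimpleGraph V) (F : V → V → V → Prop) (l : List V) (x : V)
    (hF : ∀ a b c, F a b c → G.Adj a b ∧ G.Adj a c ∧ G.Adj c b)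
    (hchain : (x :: l).IsChain G.Adj) (hlast : (x :: l).getLast? = some x)
    (h : GTriv G F (x :: l)) : NullHomotopic G F (x :: l) x := by
  classical
  let θ : ∀ u, G.Reachable x u → (Fib G F x ≃ Fib G F u) := fun u h => (fib_equiv G F x u h).some
  let g : V → V → Equiv.Perm (Fib G F x) := fun u v =>
    if h : G.Adj u v ∧ G.Reachable x u then
      ((θ v (h.2.trans h.1.reachable)).trans (tau G F u v h.1)).trans (θ u h.2).symm
    else 1
  have hg : ∀ u v (h : G.Adj u v) (hu : G.Reachable x u) (hv : G.Reachable x v) (z : Fib G F x),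
      (θ u hu (g u v z)).1 = qcons G F u (θ v hv z).1 := by
    intro u v h hu hv z
    have : g u v = ((θ v hv).trans (tau G F u v h)).trans (θ u hu).symm := by
      simp only [g]
      rw [dif_pos ⟨h, hu⟩]
    rw [this]
    simp only [Equiv.trans_apply, Equiv.apply_symm_apply]
    rfl
  have h1 := h (Equiv.Perm (Fib G F x)) g
    (by
      intro a b hab
      by_cases ha : G.Reachable x a
      · have hb := ha.trans hab.reachable
        ext z
        apply (θ a ha).injective
        apply Subtype.ext
        rw [Equiv.Perm.mul_apply, hg a b hab ha hb, hg b a hab.symm hb ha,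
          qcons_qcons G F b a hab.symm _ (θ a ha z).2]
        rfl
      · have hb : ¬ G.Reachable x b := fun hb => ha (hb.trans hab.symm.reachable)
        simp [g, ha, hb])
    (by
      intro a b c hf
      obtain ⟨hab, hac, hcb⟩ := hF a b c hf
      by_cases ha : G.Reachable x a
      · have hb := ha.trans hab.reachable
        have hc := ha.trans hac.reachable
        ext z
        apply (θ a ha).injective
        apply Subtype.ext
        rw [Equiv.Perm.mul_apply, hg a b hab ha hb, hg a c hac ha hc, hg c b hcb hc hb,
          ← qcons_tri G F a b c hf _ (θ b hb z).2]
      · have hc : ¬ G.Reachable x c := fun hb => ha (hb.trans hac.symm.reachable)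
        simp [g, ha, hc])
  have hx : G.Reachable x x := SimpleGraph.Reachable.refl x
  let y : Fib G F x := ⟨Quotient.mk (hsetoid G F) [x], rfl⟩
  have main : ∀ (l : List V) (u : V) (hu : G.Reachable x u), (u :: l).IsChain G.Adj →
      (u :: l).getLast? = some x →
      (θ u hu (prodAlong g (u :: l) ((θ x hx).symm y))).1 = Quotient.mk (hsetoid G F) (u :: l) := by
    intro l
    induction l with
    | nil =>
      intro u hu _ hl
      have : u = x := by simpa using hl
      subst this
      change (θ u hx ((θ u hx).symm y)).1 = _
      rw [Equiv.apply_symm_apply]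
    | cons v l ih =>
      intro u hu hc hl
      rw [List.isChain_cons_cons] at hc
      have hv := hu.trans hc.1.reachable
      simp only [prodAlong]
      rw [Equiv.Perm.mul_apply, hg u v hc.1 hu hv, ih v hv hc.2 (by simpa using hl)]
      rfl
  have := main l x hx hchain hlast
  rw [h1] at this
  simp only [Equiv.Perm.coe_one, id_eq, Equiv.apply_symm_apply] at this
  exact Quotient.exact this.symm

/-! ### Collapsing lemmas -/

theorem gtriv_collapse (G G' : SimpleGraph V) (F F' : V → V → V → Prop) (p q r : V) (l : List V)
    (hpr : p ≠ r) (hpq : G'.Adj p q) (hqr : G'.Adj q r)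
    (hG : ∀ u v, G.Adj u v → G'.Adj u v ∨ s(u, v) = s(p, r))
    (hF : ∀ a b c, F a b c →
      (F' a b c ∧ s(a, b) ≠ s(p, r) ∧ s(a, c) ≠ s(p, r) ∧ s(c, b) ≠ s(p, r)) ∨
      (a = p ∧ b = q ∧ c = r) ∨ (a = p ∧ b = r ∧ c = q) ∨ (a = q ∧ b = p ∧ c = r) ∨
      (a = q ∧ b = r ∧ c = p) ∨ (a = r ∧ b = p ∧ c = q) ∨ (a = r ∧ b = q ∧ c = p))
    (hl : l.IsChain (fun u v => s(u, v) ≠ s(p, r)))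
    (h : GTriv G F l) : GTriv G' F' l := by
  intro Γ _ g' h1 h2
  let g : V → V → Γ := fun u v => if u = p ∧ v = r then g' p q * g' q r else
    if u = r ∧ v = p then g' r q * g' q p else g' u v
  have hne : ∀ u v, s(u, v) ≠ s(p, r) → g u v = g' u v := by
    intro u v huv
    simp only [ne_eq, Sym2.eq_iff, not_or] at huv
    simp only [g, if_neg huv.1, if_neg huv.2]
  have gpr : g p r = g' p q * g' q r := by simp [g]
  have grp : g r p = g' r q * g' q p := by simp [g, hpr, hpr.symm]
  have npq := hpq.ne
  have nqr := hqr.ne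
  have gpq : g p q = g' p q := hne _ _ (by simp [npq, npq.symm, nqr, nqr.symm])
  have gqp : g q p = g' q p := hne _ _ (by simp [npq, npq.symm, nqr, nqr.symm])
  have gqr : g q r = g' q r := hne _ _ (by simp [npq, npq.symm, nqr, nqr.symm])
  have grq : g r q = g' r q := hne _ _ (by simp [npq, npq.symm, nqr, nqr.symm])
  have e1 := h1 _ _ hpq
  have e2 := h1 _ _ hpq.symm
  have e3 := h1 _ _ hqr
  have e4 := h1 _ _ hqr.symm
  rw [← prodAlong_congr g g' l (hl.imp fun u v huv => hne u v huv)]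
  have i1 : g' q p = (g' p q)⁻¹ := eq_inv_of_mul_eq_one_right e1
  have i2 : g' r q = (g' q r)⁻¹ := eq_inv_of_mul_eq_one_right e3
  refine h Γ g ?_ ?_
  · intro a b hab
    by_cases he : s(a, b) = s(p, r)
    · rw [Sym2.eq_iff] at he
      rcases he with ⟨rfl, rfl⟩ | ⟨rfl, rfl⟩
      · rw [gpr, grp, i1, i2]; group
      · rw [gpr, grp, i1, i2]; group
    · rw [hne a b he, hne b a (by rwa [Sym2.eq_swap])]
      exact h1 a b ((hG a b hab).resolve_right he)
  · intro a b c hf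
    rcases hF a b c hf with ⟨hf', n1, n2, n3⟩ | h | h | h | h | h | h
    · rw [hne _ _ n1, hne _ _ n2, hne _ _ n3]
      exact h2 a b c hf'
    all_goals
      obtain ⟨rfl, rfl, rfl⟩ := h
      simp only [gpr, grp, gpq, gqp, gqr, grq, i1, i2]
      try group

theorem gtriv_delete (G G' : SimpleGraph V) (F : V → V → V → Prop) (p r : V) (l : List V)
    (hG : ∀ u v, G.Adj u v → G'.Adj u v ∨ s(u, v) = s(p, r))
    (hF : ∀ a b c, F a b c →
      (s(a, b) ≠ s(p, r) ∧ s(a, c) ≠ s(p, r) ∧ s(c, b) ≠ s(p, r)))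
    (hl : l.IsChain (fun u v => s(u, v) ≠ s(p, r)))
    (h : GTriv G F l) : GTriv G' F l := by
  intro Γ _ g' h1 h2
  let g : V → V → Γ := fun u v => if s(u, v) = s(p, r) then 1 else g' u v
  have hne : ∀ u v, s(u, v) ≠ s(p, r) → g u v = g' u v := by
    intro u v huv
    simp only [g, if_neg huv]
  rw [← prodAlong_congr g g' l (hl.imp fun u v huv => hne u v huv)]
  refine h Γ g ?_ ?_
  · intro a b hab
    by_cases he : s(a, b) = s(p, r)
    · have he' : s(b, a) = s(p, r) := by rwa [Sym2.eq_swap]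
      simp only [g, if_pos he, if_pos he', mul_one]
    · rw [hne a b he, hne b a (by rwa [Sym2.eq_swap])]
      exact h1 a b ((hG a b hab).resolve_right he)
  · intro a b c hf
    obtain ⟨n1, n2, n3⟩ := hF a b c hf
    rw [hne _ _ n1, hne _ _ n2, hne _ _ n3]
    exact h2 a b c hf

theorem gtriv_component (G G' : SimpleGraph V) (F F' : V → V → V → Prop) (R : V → Prop)
    (l : List V) (hR : ∀ u v, G.Adj u v → (R u ↔ R v))
    (hG : ∀ u v, G.Adj u v → R u → G'.Adj u v)
    (hF : ∀ a b c, F a b c → (R a ↔ R c) ∧ (R a → F' a b c))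
    (hl : l.IsChain (fun u _ => R u))
    (h : GTriv G F l) : GTriv G' F' l := by
  classical
  intro Γ _ g' h1 h2
  let g : V → V → Γ := fun u v => if R u then g' u v else 1
  rw [← prodAlong_congr g g' l (hl.imp fun u v huv => by simp [g, huv])]
  refine h Γ g ?_ ?_
  · intro a b hab
    by_cases ha : R a
    · simp only [g, if_pos ha, if_pos ((hR a b hab).1 ha)]
      exact h1 a b (hG a b hab ha)
    · simp only [g, if_neg ha, if_neg (fun hb => ha ((hR a b hab).2 hb)), mul_one]
  · intro a b c hf
    obtain ⟨hac, hf'⟩ := hF a b c hf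
    by_cases ha : R a
    · simp only [g, if_pos ha, if_pos (hac.1 ha)]
      exact h2 a b c (hf' ha)
    · simp only [g, if_neg ha, if_neg (fun hb => ha (hac.2 hb)), mul_one]

/-- A cycle crossing an edge that lies in no face is not trivial. -/
theorem not_gtriv_of_free (G K : SimpleGraph V) (F : V → V → V → Prop) (x : V) (w : K.Walk x x)
    (hw : w.IsCycle) (p r : V) (he : s(p, r) ∈ w.edges)
    (hF : ∀ a b c, F a b c →
      (s(a, b) ≠ s(p, r) ∧ s(a, c) ≠ s(p, r) ∧ s(c, b) ≠ s(p, r)))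
    (h : GTriv G F w.support) : False := by
  let g : V → V → Multiplicative (ZMod 2) := fun u v =>
    if s(u, v) = s(p, r) then Multiplicative.ofAdd 1 else 1
  have key : ∀ (u v : V) (w : K.Walk u v),
      prodAlong g w.support = Multiplicative.ofAdd ((w.edges.count s(p, r) : ℕ) : ZMod 2) := by
    intro u v w
    induction w with
    | nil => rfl
    | @cons u v t h w ih =>
      rw [SimpleGraph.Walk.support_cons, SimpleGraph.Walk.edges_cons]
      have hs : w.support = v :: w.support.tail := by simp
      rw [hs, prodAlong, ← hs, ih, List.count_cons]
      by_cases hh : s(u, v) = s(p, r)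
      · simp only [g, hh, if_true, beq_self_eq_true, Nat.cast_add, Nat.cast_one, ofAdd_add, mul_comm]
      · simp only [g, hh, if_false, beq_iff_eq, one_mul, add_zero]
  have h1 := h (Multiplicative (ZMod 2)) g
    (by
      intro a b _
      have : s(b, a) = s(a, b) := Sym2.eq_swap
      simp only [g, this]
      by_cases hh : s(a, b) = s(p, r)
      · simp only [if_pos hh]; decide
      · simp only [if_neg hh]; decide)
    (by
      intro a b c hf
      obtain ⟨n1, n2, n3⟩ := hF a b c hf
      simp only [g, if_neg n1, if_neg n2, if_neg n3, one_mul])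
  rw [key, List.count_eq_one_of_mem hw.edges_nodup he] at h1
  revert h1
  decide

/-! ### Processes, recursively -/

/-- Adding the edge `ab`. -/
def addE (H : SimpleGraph V) (a b : V) : SimpleGraph V := H ⊔ SimpleGraph.fromEdgeSet {s(a, b)}

theorem addE_adj (H : SimpleGraph V) (a b u v : V) :
    (addE H a b).Adj u v ↔ H.Adj u v ∨ (s(u, v) = s(a, b) ∧ u ≠ v) := by
  simp only [addE, SimpleGraph.sup_adj, SimpleGraph.fromEdgeSet_adj, Set.mem_singleton_iff]

/-- Deleting the edge `e`. -/
def delE (H : SimpleGraph V) (e : Sym2 V) : SimpleGraph V := H.deleteEdges {e}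

theorem delE_adj (H : SimpleGraph V) (e : Sym2 V) (u v : V) :
    (delE H e).Adj u v ↔ H.Adj u v ∧ s(u, v) ≠ e := by
  simp only [delE, SimpleGraph.deleteEdges_adj, Set.mem_singleton_iff, ne_eq]

/-- Recursive validity. -/
def Val : SimpleGraph V → List (V × V × V) → Prop
  | _, [] => True
  | H, st :: S => st.1 ≠ st.2.1 ∧ ¬ H.Adj st.1 st.2.1 ∧ H.Adj st.1 st.2.2 ∧ H.Adj st.2.1 st.2.2 ∧
      Val (addE H st.1 st.2.1) S

/-- Recursive final graph. -/
def fin : SimpleGraph V → List (V × V × V) → SimpleGraph V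
  | H, [] => H
  | H, st :: S => fin (addE H st.1 st.2.1) S

theorem afterGraph_adj (H : SimpleGraph V) (S : List (V × V × V)) (u v : V) :
    (afterGraph H S).Adj u v ↔ H.Adj u v ∨ ((∃ st ∈ S, s(u, v) ∈ triEdges st) ∧ u ≠ v) := by
  simp only [afterGraph, SimpleGraph.sup_adj, SimpleGraph.fromEdgeSet_adj, Set.mem_ofPred_eq]

theorem afterGraph_nil (H : SimpleGraph V) : afterGraph H [] = H := by
  ext u v; simp [afterGraph_adj]

theorem afterGraph_cons (H : SimpleGraph V) (st : V × V × V) (S : List (V × V × V))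
    (h1 : H.Adj st.1 st.2.2) (h2 : H.Adj st.2.1 st.2.2) :
    afterGraph H (st :: S) = afterGraph (addE H st.1 st.2.1) S := by
  ext u v
  simp only [afterGraph_adj, addE_adj, List.mem_cons, exists_eq_or_imp]
  have key : s(u, v) ∈ triEdges st → s(u, v) = s(st.1, st.2.1) ∨ H.Adj u v := by
    intro h
    simp only [triEdges, Set.mem_insert_iff, Set.mem_singleton_iff] at h
    rcases h with h | h | h
    · exact Or.inl h
    · right; rw [← SimpleGraph.mem_edgeSet, h]; exact h1
    · right; rw [← SimpleGraph.mem_edgeSet, h]; exact h2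
  have key2 : s(u, v) = s(st.1, st.2.1) → s(u, v) ∈ triEdges st := by
    intro h; simp [triEdges, h]
  tauto

theorem valid_cons (H : SimpleGraph V) (st : V × V × V) (S : List (V × V × V)) :
    IsValidProcess H (st :: S) ↔ st.1 ≠ st.2.1 ∧ ¬ H.Adj st.1 st.2.1 ∧ H.Adj st.1 st.2.2 ∧
      H.Adj st.2.1 st.2.2 ∧ IsValidProcess (addE H st.1 st.2.1) S := by
  constructor
  · intro h
    have h0 := h 0 (by simp)
    simp only [List.get_eq_getElem, List.getElem_cons_zero, List.take_zero, afterGraph_nil] at h0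
    refine ⟨h0.1, h0.2.1, h0.2.2.1, h0.2.2.2, ?_⟩
    intro i hi
    have := h (i + 1) (by simpa using hi)
    simp only [List.get_eq_getElem, List.getElem_cons_succ, List.take_succ_cons] at this
    rw [afterGraph_cons H st _ h0.2.2.1 h0.2.2.2] at this
    exact this
  · rintro ⟨h1, h2, h3, h4, h5⟩ i hi
    cases i with
    | zero =>
      simp only [List.get_eq_getElem, List.getElem_cons_zero, List.take_zero, afterGraph_nil]
      exact ⟨h1, h2, h3, h4⟩
    | succ i =>
      have := h5 i (by simpa using hi)
      simp only [List.get_eq_getElem, List.getElem_cons_succ, List.take_succ_cons]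
      rw [afterGraph_cons H st _ h3 h4]
      exact this

theorem valid_iff_val (H : SimpleGraph V) (S : List (V × V × V)) :
    IsValidProcess H S ↔ Val H S := by
  induction S generalizing H with
  | nil => simp [Val, IsValidProcess]
  | cons st S ih => rw [valid_cons, Val, ih]

theorem afterGraph_eq_fin (H : SimpleGraph V) (S : List (V × V × V)) (h : Val H S) :
    afterGraph H S = fin H S := by
  induction S generalizing H with
  | nil => exact afterGraph_nil H
  | cons st S ih =>
    obtain ⟨_, _, h3, h4, h5⟩ := h
    rw [afterGraph_cons H st S h3 h4, ih _ h5, fin]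

theorem le_addE (H : SimpleGraph V) (a b : V) : H ≤ addE H a b := le_sup_left

theorem le_fin (H : SimpleGraph V) (S : List (V × V × V)) : H ≤ fin H S := by
  induction S generalizing H with
  | nil => exact le_rfl
  | cons st S ih => exact (le_addE H _ _).trans (ih _)

theorem val_append (H : SimpleGraph V) (S T : List (V × V × V)) :
    Val H (S ++ T) ↔ Val H S ∧ Val (fin H S) T := by
  induction S generalizing H with
  | nil => simp [Val, fin]
  | cons st S ih => simp only [List.cons_append, Val, fin, ih]; tauto

theorem fin_append (H : SimpleGraph V) (S T : List (V × V × V)) :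
    fin H (S ++ T) = fin (fin H S) T := by
  induction S generalizing H with
  | nil => rfl
  | cons st S ih => simp only [List.cons_append, fin, ih]

theorem delE_addE (H : SimpleGraph V) (e : Sym2 V) (a b : V) (h : e ≠ s(a, b)) :
    addE (delE H e) a b = delE (addE H a b) e := by
  ext u v
  simp only [addE_adj, delE_adj]
  constructor
  · rintro (h1 | h1)
    · exact ⟨Or.inl h1.1, h1.2⟩
    · exact ⟨Or.inr h1, by rw [h1.1]; exact h.symm⟩
  · tauto

theorem addE_comm (H : SimpleGraph V) (a b c d : V) :
    addE (addE H a b) c d = addE (addE H c d) a b := by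
  ext u v; simp only [addE_adj]; tauto

theorem delE_addE_self (H : SimpleGraph V) (a b : V) (h : ¬ H.Adj a b) :
    delE (addE H a b) s(a, b) = H := by
  ext u v
  simp only [addE_adj, delE_adj]
  constructor
  · tauto
  · intro h1
    refine ⟨Or.inl h1, fun h2 => h ?_⟩
    rw [← SimpleGraph.mem_edgeSet, ← h2]; exact h1

theorem val_del (H : SimpleGraph V) (S : List (V × V × V)) (e : Sym2 V) (h : Val H S)
    (he : e ∈ H.edgeSet)
    (hu : ∀ st ∈ S, e ≠ s(st.1, st.2.2) ∧ e ≠ s(st.2.1, st.2.2)) :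
    Val (delE H e) S ∧ fin (delE H e) S = delE (fin H S) e := by
  induction S generalizing H with
  | nil => exact ⟨trivial, rfl⟩
  | cons st S ih =>
    obtain ⟨h1, h2, h3, h4, h5⟩ := h
    have hne : e ≠ s(st.1, st.2.1) := by rintro rfl; exact h2 he
    have hst := hu st (by simp)
    have := ih _ h5 (SimpleGraph.edgeSet_mono (le_addE H _ _) he)
      (fun t ht => hu t (List.mem_cons_of_mem _ ht))
    rw [← delE_addE H e _ _ hne] at this
    refine ⟨⟨h1, fun h => h2 ((delE_adj _ _ _ _).1 h).1, (delE_adj _ _ _ _).2 ⟨h3, hst.1.symm⟩,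
      (delE_adj _ _ _ _).2 ⟨h4, hst.2.symm⟩, this.1⟩, ?_⟩
    exact this.2

theorem val_add (H : SimpleGraph V) (S : List (V × V × V)) (a b : V) (h : Val H S) (hab : a ≠ b)
    (he : ¬ (fin H S).Adj a b) :
    Val (addE H a b) S ∧ fin (addE H a b) S = addE (fin H S) a b := by
  induction S generalizing H with
  | nil => exact ⟨trivial, rfl⟩
  | cons st S ih =>
    obtain ⟨h1, h2, h3, h4, h5⟩ := h
    have := ih _ h5 he
    rw [addE_comm] at this
    refine ⟨⟨h1, ?_, le_addE _ _ _ h3, le_addE _ _ _ h4, this.1⟩, this.2⟩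
    rw [addE_adj]
    rintro (h | ⟨h, -⟩)
    · exact h2 h
    · apply he
      have : (addE H st.1 st.2.1).Adj a b := (addE_adj _ _ _ _ _).2 (Or.inr ⟨h.symm, hab⟩)
      exact le_fin (addE H st.1 st.2.1) S this

theorem fin_cases (H : SimpleGraph V) (S : List (V × V × V)) (e : Sym2 V)
    (he : e ∈ (fin H S).edgeSet) : e ∈ H.edgeSet ∨ ∃ st ∈ S, e = s(st.1, st.2.1) := by
  induction S generalizing H with
  | nil => exact Or.inl he
  | cons st S ih =>
    rcases ih _ he with h | ⟨t, ht, h⟩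
    · induction e using Sym2.ind with
      | _ u v =>
        rw [SimpleGraph.mem_edgeSet, addE_adj] at h
        rcases h with h | h
        · exact Or.inl h
        · exact Or.inr ⟨st, by simp, h.1⟩
    · exact Or.inr ⟨t, by simp [ht], h⟩

theorem val_mem (H : SimpleGraph V) (S : List (V × V × V)) (h : Val H S) (st : V × V × V)
    (hst : st ∈ S) : ¬ H.Adj st.1 st.2.1 ∧ (fin H S).Adj st.1 st.2.1 ∧
      (fin H S).Adj st.1 st.2.2 ∧ (fin H S).Adj st.2.1 st.2.2 := by
  induction S generalizing H with
  | nil => simp at hst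
  | cons t S ih =>
    obtain ⟨h1, h2, h3, h4, h5⟩ := h
    rcases List.mem_cons.1 hst with rfl | hst
    · have hle : addE H st.1 st.2.1 ≤ fin H (st :: S) := le_fin _ _
      exact ⟨h2, hle ((addE_adj _ _ _ _ _).2 (Or.inr ⟨rfl, h1⟩)), hle (le_addE _ _ _ h3),
        hle (le_addE _ _ _ h4)⟩
    · obtain ⟨i1, i2⟩ := ih _ h5 hst
      exact ⟨fun h => i1 (le_addE _ _ _ h), i2⟩

theorem fin_reach (H : SimpleGraph V) (S : List (V × V × V)) (h : Val H S) (u v : V)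
    (huv : (fin H S).Adj u v) : H.Reachable u v := by
  induction S generalizing H u v with
  | nil => exact huv.reachable
  | cons t S ih =>
    obtain ⟨h1, h2, h3, h4, h5⟩ := h
    obtain ⟨p⟩ := ih _ h5 u v huv
    clear huv
    induction p with
    | nil => exact SimpleGraph.Reachable.refl _
    | @cons u v w hh p ihp =>
      refine SimpleGraph.Reachable.trans ?_ ihp
      rcases (addE_adj _ _ _ _ _).1 hh with hh | ⟨hh, -⟩
      · exact hh.reachable
      · have := h3.reachable.trans h4.symm.reachable
        rw [Sym2.eq_iff] at hh
        rcases hh with ⟨rfl, rfl⟩ | ⟨rfl, rfl⟩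
        · exact this
        · exact this.symm

/-- Restriction of a graph to edges starting in `R`. -/
def resG (R : V → Prop) (H : SimpleGraph V) : SimpleGraph V where
  Adj u v := H.Adj u v ∧ R u ∧ R v
  symm := ⟨fun _ _ h => ⟨h.1.symm, h.2.2, h.2.1⟩⟩
  loopless := ⟨fun _ h => h.1.ne rfl⟩

open scoped Classical in
theorem val_res (H : SimpleGraph V) (S : List (V × V × V)) (R : V → Prop) (h : Val H S)
    (hR : ∀ u v, (fin H S).Adj u v → (R u ↔ R v)) :
    Val (resG R H) (S.filter (fun st => R st.1)) ∧
      fin (resG R H) (S.filter (fun st => R st.1)) = resG R (fin H S) := by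
  induction S generalizing H with
  | nil => exact ⟨trivial, rfl⟩
  | cons st S ih =>
    have hm := val_mem H (st :: S) h st (by simp)
    obtain ⟨h1, h2, h3, h4, h5⟩ := h
    have := ih _ h5 hR
    have r1 := hR _ _ hm.2.1
    have r2 := hR _ _ hm.2.2.1
    by_cases hs : R st.1
    · have e : resG R (addE H st.1 st.2.1) = addE (resG R H) st.1 st.2.1 := by
        ext u v
        simp only [resG, addE_adj, Sym2.eq_iff]
        constructor
        · tauto
        · rintro (h | ⟨(⟨rfl, rfl⟩ | ⟨rfl, rfl⟩), h⟩)
          · tauto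
          · tauto
          · tauto
      rw [e] at this
      rw [List.filter_cons_of_pos (by simpa using hs)]
      exact ⟨⟨h1, fun h => h2 h.1, ⟨h3, hs, r2.1 hs⟩, ⟨h4, r1.1 hs, r2.1 hs⟩, this.1⟩, this.2⟩
    · have e : resG R (addE H st.1 st.2.1) = resG R H := by
        ext u v
        simp only [resG, addE_adj, Sym2.eq_iff]
        constructor
        · rintro ⟨(h | ⟨(⟨rfl, rfl⟩ | ⟨rfl, rfl⟩), h⟩), h'⟩
          · tauto
          · tauto
          · tauto
        · tauto
      rw [e] at this
      rw [List.filter_cons_of_neg (by simpa using hs)]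
      exact this

theorem perm_of_set_eq (x y z a b c : V) (hab : a ≠ b) (hac : a ≠ c) (hbc : b ≠ c)
    (h : ({x, y, z} : Set V) = {a, b, c}) :
    (x = a ∧ y = b ∧ z = c) ∨ (x = a ∧ y = c ∧ z = b) ∨ (x = b ∧ y = a ∧ z = c) ∨
    (x = b ∧ y = c ∧ z = a) ∨ (x = c ∧ y = a ∧ z = b) ∨ (x = c ∧ y = b ∧ z = a) := by
  have hx : x ∈ ({a, b, c} : Set V) := by rw [← h]; simp
  have hy : y ∈ ({a, b, c} : Set V) := by rw [← h]; simp
  have hz : z ∈ ({a, b, c} : Set V) := by rw [← h]; simp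
  have ha : a ∈ ({x, y, z} : Set V) := by rw [h]; simp
  have hb : b ∈ ({x, y, z} : Set V) := by rw [h]; simp
  have hc : c ∈ ({x, y, z} : Set V) := by rw [h]; simp
  simp only [Set.mem_insert_iff, Set.mem_singleton_iff] at hx hy hz ha hb hc
  clear h
  grind

theorem con_zero (S : List (V × V × V)) (e : Sym2 V) (h : conA S e = 0) :
    ∀ st ∈ S, e ≠ s(st.1, st.2.2) ∧ e ≠ s(st.2.1, st.2.2) := by
  intro st hst
  rw [conA, Finite.card_eq_zero_iff] at h
  obtain ⟨i, hi⟩ := List.get_of_mem hst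
  constructor
  · intro he
    exact h.false ⟨i, by rw [hi]; exact Or.inl he⟩
  · intro he
    exact h.false ⟨i, by rw [hi]; exact Or.inr he⟩

theorem con_one (S : List (V × V × V)) (e : Sym2 V) (h : conA S e = 1) :
    ∃ S₁ st S₂, S = S₁ ++ st :: S₂ ∧ (e = s(st.1, st.2.2) ∨ e = s(st.2.1, st.2.2)) ∧
      ∀ t ∈ S₁ ++ S₂, e ≠ s(t.1, t.2.2) ∧ e ≠ s(t.2.1, t.2.2) := by
  rw [conA, Nat.card_eq_one_iff_unique] at h
  obtain ⟨hsub, ⟨⟨⟨i, hi⟩, hP⟩⟩⟩ := h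
  have uniq : ∀ j (hj : j < S.length), (e = s((S[j]).1, (S[j]).2.2) ∨
      e = s((S[j]).2.1, (S[j]).2.2)) → j = i := by
    intro j hj hPj
    have := hsub.elim ⟨⟨j, hj⟩, hPj⟩ ⟨⟨i, hi⟩, hP⟩
    simpa using this
  have hS : S = S.take i ++ S[i] :: S.drop (i + 1) := by
    rw [List.cons_getElem_drop_succ, List.take_append_drop]
  refine ⟨S.take i, S[i], S.drop (i + 1), hS, hP, ?_⟩
  intro t ht
  have : ∃ j, ∃ hj : j < S.length, S[j] = t ∧ j ≠ i := by
    rcases List.mem_append.1 ht with ht | ht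
    · obtain ⟨j, hj, rfl⟩ := List.mem_iff_getElem.1 ht
      have : j < i ∧ j < S.length := by simpa using hj
      exact ⟨j, this.2, by simp, by omega⟩
    · obtain ⟨j, hj, rfl⟩ := List.mem_iff_getElem.1 ht
      have : j < S.length - (i + 1) := by simpa using hj
      exact ⟨i + 1 + j, by omega, by simp, by omega⟩
  obtain ⟨j, hj, rfl, hji⟩ := this
  exact ⟨fun h => hji (uniq j hj (Or.inl h)), fun h => hji (uniq j hj (Or.inr h))⟩

theorem face_perm (K : SimpleGraph V) (st : V × V × V) (h1 : K.Adj st.1 st.2.1)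
    (h2 : K.Adj st.1 st.2.2) (h3 : K.Adj st.2.1 st.2.2) (a b c : V)
    (h : ({a, b, c} : Set V) = {st.1, st.2.1, st.2.2}) :
    s(a, b) ∈ triEdges st ∧ s(a, c) ∈ triEdges st ∧ s(c, b) ∈ triEdges st := by
  have := perm_of_set_eq a b c _ _ _ h1.ne h2.ne h3.ne h
  simp only [triEdges, Set.mem_insert_iff, Set.mem_singleton_iff, Sym2.eq_iff]
  tauto

theorem face_edges (H : SimpleGraph V) (S : List (V × V × V)) (h : Val H S) (a b c : V)
    (hf : facesOf S a b c) : ∃ st ∈ S, ({a, b, c} : Set V) = {st.1, st.2.1, st.2.2} ∧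
      s(a, b) ∈ triEdges st ∧ s(a, c) ∈ triEdges st ∧ s(c, b) ∈ triEdges st := by
  obtain ⟨st, hst, he⟩ := hf
  obtain ⟨_, h1, h2, h3⟩ := val_mem H S h st hst
  exact ⟨st, hst, he, face_perm _ st h1 h2 h3 a b c he⟩

theorem tri_adj (H : SimpleGraph V) (S : List (V × V × V)) (h : Val H S) (st : V × V × V)
    (hst : st ∈ S) (u v : V) (huv : s(u, v) ∈ triEdges st) : (fin H S).Adj u v := by
  obtain ⟨_, h1, h2, h3⟩ := val_mem H S h st hst
  simp only [triEdges, Set.mem_insert_iff, Set.mem_singleton_iff] at huv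
  rw [← SimpleGraph.mem_edgeSet]
  rcases huv with h | h | h <;> rw [h] <;> assumption

theorem face_adj (H : SimpleGraph V) (S : List (V × V × V)) (h : Val H S) (a b c : V)
    (hf : facesOf S a b c) : (fin H S).Adj a b ∧ (fin H S).Adj a c ∧ (fin H S).Adj c b := by
  obtain ⟨st, hst, -, h1, h2, h3⟩ := face_edges H S h a b c hf
  exact ⟨tri_adj H S h st hst _ _ h1, tri_adj H S h st hst _ _ h2, tri_adj H S h st hst _ _ h3⟩

theorem collapse_gtriv (H : SimpleGraph V) (S₁ S₂ : List (V × V × V)) (st : V × V × V)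
    (h : Val H (S₁ ++ st :: S₂)) (e : Sym2 V) (he : e ∈ triEdges st)
    (hne : ∀ t ∈ S₁ ++ S₂, e ∉ triEdges t) (l : List V)
    (hl : l.IsChain (fun u v => s(u, v) ≠ e))
    (ht : GTriv (fin H (S₁ ++ st :: S₂)) (facesOf (S₁ ++ st :: S₂)) l) :
    GTriv (delE (fin H (S₁ ++ st :: S₂)) e) (facesOf (S₁ ++ S₂)) l := by
  obtain ⟨_, h1, h2, h3⟩ := val_mem H _ h st (by simp)
  have key : ∀ p q r : V, e = s(p, r) → (fin H (S₁ ++ st :: S₂)).Adj p q →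
      (fin H (S₁ ++ st :: S₂)).Adj q r → p ≠ r →
      ({st.1, st.2.1, st.2.2} : Set V) = {p, q, r} →
      GTriv (delE (fin H (S₁ ++ st :: S₂)) e) (facesOf (S₁ ++ S₂)) l := by
    rintro p q r rfl hpq hqr hpr hset
    refine gtriv_collapse _ _ _ _ p q r l hpr ?_ ?_ ?_ ?_ hl ht
    · rw [delE_adj]
      exact ⟨hpq, by simp [hqr.ne, hpr, hqr.ne']⟩
    · rw [delE_adj]
      exact ⟨hqr, by simp [hqr.ne, hpr, hpq.ne']⟩
    · intro u v huv
      rw [delE_adj]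
      tauto
    · intro a b c hf
      obtain ⟨t, ht, hs, e1, e2, e3⟩ := face_edges H _ h a b c hf
      by_cases htt : t ∈ S₁ ++ S₂
      · have := hne t htt
        refine Or.inl ⟨⟨t, htt, hs⟩, ?_, ?_, ?_⟩ <;> intro hh <;> simp_all only [not_true_eq_false]
      · have : t = st := by
          simp only [List.mem_append, List.mem_cons] at ht htt
          tauto
        subst this
        right
        exact perm_of_set_eq a b c p q r hpq.ne hpr hqr.ne (hs.trans hset)
  simp only [triEdges, Set.mem_insert_iff, Set.mem_singleton_iff] at he
  rcases he with he | he | he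
  · exact key _ st.2.2 _ he h2 h3.symm h1.ne (by ext z; simp; tauto)
  · exact key _ st.2.1 _ he h1 h3 h2.ne rfl
  · exact key _ st.1 _ he h1.symm h2 h3.ne (by ext z; simp; tauto)

/-- The invariant of the reduction. -/
structure Good (K₀ C : SimpleGraph V) (S₀ : List (V × V × V)) (l : List V)
    (H : SimpleGraph V) (S : List (V × V × V)) : Prop where
  val : Val H S
  sub : S.Sublist S₀
  le : fin H S ≤ K₀
  cle : C ≤ fin H S
  triv : GTriv (fin H S) (facesOf S) l

theorem delE_le (K : SimpleGraph V) (e : Sym2 V) : delE K e ≤ K :=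
  fun u v h => ((delE_adj K e u v).1 h).1

theorem delE_lt (K : SimpleGraph V) (e : Sym2 V) (he : e ∈ K.edgeSet) : delE K e < K := by
  refine lt_of_le_of_ne (delE_le K e) ?_
  intro h
  induction e using Sym2.ind with
  | _ u v =>
    rw [← h, SimpleGraph.mem_edgeSet, delE_adj] at he
    exact he.2 rfl

theorem le_delE (C K : SimpleGraph V) (e : Sym2 V) (h : C ≤ K) (he : e ∉ C.edgeSet) :
    C ≤ delE K e := by
  intro u v huv
  rw [delE_adj]
  refine ⟨h huv, ?_⟩
  rintro rfl
  exact he huv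

theorem chain_ne (C : SimpleGraph V) (l : List V) (hl : l.IsChain C.Adj) (e : Sym2 V)
    (he : e ∉ C.edgeSet) : l.IsChain (fun u v => s(u, v) ≠ e) := by
  refine hl.imp ?_
  rintro u v huv rfl
  exact he huv

/-- Deleting an unused starting edge. -/
theorem good_delete (K₀ C : SimpleGraph V) (S₀ : List (V × V × V)) (l : List V)
    (H : SimpleGraph V) (S : List (V × V × V)) (hg : Good K₀ C S₀ l H S)
    (hl : l.IsChain C.Adj) (e : Sym2 V) (heC : e ∉ C.edgeSet) (heH : e ∈ H.edgeSet)
    (hcon : conA S e = 0) :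
    ∃ H' S', Good K₀ C S₀ l H' S' ∧ fin H' S' < fin H S := by
  have hu := con_zero S e hcon
  obtain ⟨v1, v2⟩ := val_del H S e hg.val heH hu
  have hlt := delE_lt (fin H S) e (SimpleGraph.edgeSet_mono (le_fin H S) heH)
  refine ⟨delE H e, S, ⟨v1, hg.sub, ?_, ?_, ?_⟩, ?_⟩
  · rw [v2]; exact (delE_le _ _).trans hg.le
  · rw [v2]; exact le_delE _ _ _ hg.cle heC
  · rw [v2]
    have hch := chain_ne C l hl e heC
    have hnot : ∀ st ∈ S, e ∉ triEdges st := by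
      intro st hst h
      simp only [triEdges, Set.mem_insert_iff, Set.mem_singleton_iff] at h
      rcases h with h | h | h
      · rw [h] at heH
        exact (val_mem H S hg.val st hst).1 heH
      · exact (hu st hst).1 h
      · exact (hu st hst).2 h
    induction e using Sym2.ind with
    | _ p r =>
      refine gtriv_delete (fin H S) _ _ p r l ?_ ?_ hch hg.triv
      · intro u v huv
        rw [delE_adj]
        tauto
      · intro a b c hf
        obtain ⟨t, ht, hs, e1, e2, e3⟩ := face_edges H _ hg.val a b c hf
        have := hnot t ht
        refine ⟨?_, ?_, ?_⟩ <;> intro hh <;> simp_all only [not_true_eq_false]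
  · rw [v2]; exact hlt

/-- Removing a collapsible face. -/
theorem good_collapse (K₀ C : SimpleGraph V) (S₀ : List (V × V × V)) (l : List V)
    (H : SimpleGraph V) (S₁ S₂ : List (V × V × V)) (st : V × V × V)
    (hg : Good K₀ C S₀ l H (S₁ ++ st :: S₂))
    (hl : l.IsChain C.Adj) (e : Sym2 V) (heC : e ∉ C.edgeSet) (he : e ∈ triEdges st)
    (hne : ∀ t ∈ S₁ ++ S₂, e ∉ triEdges t) (H' : SimpleGraph V) (hv : Val H' (S₁ ++ S₂))
    (hf : fin H' (S₁ ++ S₂) = delE (fin H (S₁ ++ st :: S₂)) e) :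
    ∃ H' S', Good K₀ C S₀ l H' S' ∧ fin H' S' < fin H (S₁ ++ st :: S₂) := by
  have heK : e ∈ (fin H (S₁ ++ st :: S₂)).edgeSet := by
    induction e using Sym2.ind with
    | _ p r => exact tri_adj H _ hg.val st (by simp) p r he
  refine ⟨H', S₁ ++ S₂, ⟨hv, ?_, ?_, ?_, ?_⟩, ?_⟩
  · refine List.Sublist.trans ?_ hg.sub
    exact (List.Sublist.refl _).append (List.sublist_cons_self _ _)
  · rw [hf]; exact (delE_le _ _).trans hg.le
  · rw [hf]; exact le_delE _ _ _ hg.cle heC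
  · rw [hf]
    exact collapse_gtriv H S₁ S₂ st hg.val e he hne l (chain_ne C l hl e heC) hg.triv
  · rw [hf]; exact delE_lt _ _ heK

/-- A starting edge outside `C` used exactly once. -/
theorem good_one (K₀ C : SimpleGraph V) (S₀ : List (V × V × V)) (l : List V)
    (H : SimpleGraph V) (S : List (V × V × V)) (hg : Good K₀ C S₀ l H S)
    (hl : l.IsChain C.Adj) (e : Sym2 V) (heC : e ∉ C.edgeSet) (heH : e ∈ H.edgeSet)
    (hcon : conA S e = 1) :
    ∃ H' S', Good K₀ C S₀ l H' S' ∧ fin H' S' < fin H S := by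
  obtain ⟨S₁, st, S₂, rfl, hst, hu⟩ := con_one S e hcon
  have hnact : ∀ t ∈ S₁ ++ st :: S₂, e ≠ s(t.1, t.2.1) := by
    rintro t ht rfl
    exact (val_mem H _ hg.val t ht).1 heH
  have hv := hg.val
  rw [val_append] at hv
  obtain ⟨hv1, h1, h2, h3, h4, hv2⟩ := hv
  have d1 := val_del H S₁ e hv1 heH (fun t ht => hu t (by simp [ht]))
  have hest := hnact st (by simp)
  have a1 := val_add (delE H e) S₁ st.1 st.2.1 d1.1 h1
    (by rw [d1.2, delE_adj]; exact fun h => h2 h.1)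
  have d2 := val_del _ S₂ e hv2
    (SimpleGraph.edgeSet_mono ((le_fin H S₁).trans (le_addE _ _ _)) heH)
    (fun t ht => hu t (by simp [ht]))
  have hmid : fin (addE (delE H e) st.1 st.2.1) S₁ = delE (addE (fin H S₁) st.1 st.2.1) e := by
    rw [a1.2, d1.2, delE_addE _ _ _ _ hest]
  refine good_collapse K₀ C S₀ l H S₁ S₂ st hg hl e heC ?_ ?_ (addE (delE H e) st.1 st.2.1) ?_ ?_
  · simp only [triEdges, Set.mem_insert_iff, Set.mem_singleton_iff]; tauto
  · intro t ht h
    have ht' : t ∈ S₁ ++ st :: S₂ := by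
      simp only [List.mem_append, List.mem_cons] at ht ⊢; tauto
    simp only [triEdges, Set.mem_insert_iff, Set.mem_singleton_iff] at h
    rcases h with h | h | h
    · exact hnact t ht' h
    · exact (hu t ht).1 h
    · exact (hu t ht).2 h
  · rw [val_append, hmid]
    exact ⟨a1.1, d2.1⟩
  · rw [fin_append, hmid, d2.2, fin_append]
    rfl

/-- An activated edge outside `C` that is never used. -/
theorem good_act (K₀ C : SimpleGraph V) (S₀ : List (V × V × V)) (l : List V)
    (H : SimpleGraph V) (S : List (V × V × V)) (hg : Good K₀ C S₀ l H S)
    (hl : l.IsChain C.Adj) (e : Sym2 V) (heC : e ∉ C.edgeSet) (heH : e ∉ H.edgeSet)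
    (heK : e ∈ (fin H S).edgeSet) (hcon : conA S e = 0) :
    ∃ H' S', Good K₀ C S₀ l H' S' ∧ fin H' S' < fin H S := by
  have hu := con_zero S e hcon
  obtain ⟨st, hst, he⟩ := (fin_cases H S e heK).resolve_left heH
  obtain ⟨S₁, S₂, rfl⟩ := List.append_of_mem hst
  have hv := hg.val
  rw [val_append] at hv
  obtain ⟨hv1, h1, h2, h3, h4, hv2⟩ := hv
  have heA : e ∈ (addE (fin H S₁) st.1 st.2.1).edgeSet := by
    rw [he, SimpleGraph.mem_edgeSet, addE_adj]
    exact Or.inr ⟨rfl, h1⟩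
  have d2 := val_del _ S₂ e hv2 heA (fun t ht => hu t (by simp [ht]))
  have hdel : delE (addE (fin H S₁) st.1 st.2.1) e = fin H S₁ := by
    rw [he]; exact delE_addE_self _ _ _ h2
  rw [hdel] at d2
  refine good_collapse K₀ C S₀ l H S₁ S₂ st hg hl e heC ?_ ?_ H ?_ ?_
  · simp only [triEdges, Set.mem_insert_iff, Set.mem_singleton_iff]; tauto
  · intro t ht h
    have ht' : t ∈ S₁ ++ st :: S₂ := by
      simp only [List.mem_append, List.mem_cons] at ht ⊢; tauto
    simp only [triEdges, Set.mem_insert_iff, Set.mem_singleton_iff] at h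
    rcases h with h | h | h
    · rcases List.mem_append.1 ht with ht | ht
      · have := (val_mem H S₁ hv1 t ht).2.1
        rw [← SimpleGraph.mem_edgeSet, ← h, he] at this
        exact h2 this
      · have := (val_mem _ S₂ hv2 t ht).1
        rw [← SimpleGraph.mem_edgeSet, ← h] at this
        exact this heA
    · exact (hu t ht').1 h
    · exact (hu t ht').2 h
  · rw [val_append]
    exact ⟨hv1, d2.1⟩
  · rw [fin_append, d2.2, fin_append]
    rfl

/-- Passing to the component of `x`. -/
theorem good_component (K₀ C : SimpleGraph V) (S₀ : List (V × V × V)) (l : List V) (x : V)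
    (H : SimpleGraph V) (S : List (V × V × V)) (hg : Good K₀ C S₀ l H S)
    (hl : l.IsChain C.Adj) (hCx : ∀ u v, C.Adj u v → H.Reachable x u)
    (z : V) (hz : z ∈ H.support) (hxz : ¬ H.Reachable x z) :
    ∃ H' S', Good K₀ C S₀ l H' S' ∧ fin H' S' < fin H S := by
  classical
  have hR : ∀ u v, (fin H S).Adj u v → (H.Reachable x u ↔ H.Reachable x v) := by
    intro u v huv
    have := fin_reach H S hg.val u v huv
    exact ⟨fun h => h.trans this, fun h => h.trans this.symm⟩
  obtain ⟨v1, v2⟩ := val_res H S (H.Reachable x) hg.val hR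
  have hle : resG (H.Reachable x) (fin H S) ≤ fin H S := fun u v h => h.1
  refine ⟨_, _, ⟨v1, List.filter_sublist.trans hg.sub, ?_, ?_, ?_⟩, ?_⟩
  · rw [v2]; exact hle.trans hg.le
  · rw [v2]
    intro u v huv
    exact ⟨hg.cle huv, hCx u v huv, hCx v u huv.symm⟩
  · rw [v2]
    refine gtriv_component (fin H S) _ (facesOf S) _ (H.Reachable x) l hR ?_ ?_ ?_ hg.triv
    · intro u v huv hu
      exact ⟨huv, hu, (hR u v huv).1 hu⟩
    · intro a b c hf
      obtain ⟨f1, f2, f3⟩ := face_adj H S hg.val a b c hf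
      refine ⟨hR a c f2, fun ha => ?_⟩
      obtain ⟨st, hst, hs⟩ := hf
      refine ⟨st, ?_, hs⟩
      rw [List.mem_filter]
      refine ⟨hst, ?_⟩
      have hm : st.1 ∈ ({a, b, c} : Set V) := by rw [hs]; simp
      simp only [Set.mem_insert_iff, Set.mem_singleton_iff] at hm
      refine @decide_eq_true _ (_) ?_
      rcases hm with h | h | h <;> rw [h]
      · exact ha
      · exact (hR a b f1).1 ha
      · exact (hR a c f2).1 ha
    · exact hl.imp fun u v huv => hCx u v huv
  · rw [v2]
    refine lt_of_le_of_ne hle ?_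
    intro h
    obtain ⟨z', hz'⟩ := hz
    have : (fin H S).Adj z z' := le_fin H S hz'
    rw [← h] at this
    exact hxz this.2.1

theorem main_induction (K₀ C : SimpleGraph V) (S₀ : List (V × V × V)) (x : V) (w : K₀.Walk x x)
    (hw : w.IsCycle) (hCw : C.edgeSet = {e | e ∈ w.edges}) (hl : w.support.IsChain C.Adj)
    (K : SimpleGraph V) :
    ∀ (H : SimpleGraph V) (S : List (V × V × V)), Good K₀ C S₀ w.support H S → fin H S = K →
    ∃ H' S', Good K₀ C S₀ w.support H' S' ∧ (∀ e ∈ (fin H' S').edgeSet, 0 ≤ excA H' C S' e) ∧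
      EdgeConnected H' := by
  induction K using WellFoundedLT.induction with
  | _ K ih =>
  intro H S hg hK
  subst hK
  by_cases hstep : ∃ H' S', Good K₀ C S₀ w.support H' S' ∧ fin H' S' < fin H S
  · obtain ⟨H', S', hg', hlt⟩ := hstep
    exact ih _ hlt H' S' hg' rfl
  refine ⟨H, S, hg, ?_, ?_⟩
  · intro e heK
    by_contra hneg
    push Not at hneg
    by_cases heC : e ∈ C.edgeSet
    · by_cases heH : e ∈ H.edgeSet
      · simp only [excA, if_pos heC, if_pos heH] at hneg
        have h0 : conA S e = 0 := by omega
        have hu := con_zero S e h0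
        have hew : e ∈ w.edges := by rw [hCw] at heC; exact heC
        have hnot : ∀ st ∈ S, e ∉ triEdges st := by
          intro st hst h
          simp only [triEdges, Set.mem_insert_iff, Set.mem_singleton_iff] at h
          rcases h with h | h | h
          · rw [h] at heH
            exact (val_mem H S hg.val st hst).1 heH
          · exact (hu st hst).1 h
          · exact (hu st hst).2 h
        induction e using Sym2.ind with
        | _ p r =>
          refine not_gtriv_of_free (fin H S) K₀ (facesOf S) x w hw p r hew ?_ hg.triv
          intro a b c hf
          obtain ⟨t, ht, hs, e1, e2, e3⟩ := face_edges H _ hg.val a b c hf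
          have := hnot t ht
          refine ⟨?_, ?_, ?_⟩ <;> intro hh <;> simp_all only [not_true_eq_false]
      · simp only [excA, if_pos heC, if_neg heH] at hneg
        omega
    · by_cases heH : e ∈ H.edgeSet
      · simp only [excA, if_neg heC, if_pos heH] at hneg
        have h0 : conA S e = 0 ∨ conA S e = 1 := by omega
        rcases h0 with h0 | h0
        · exact hstep (good_delete K₀ C S₀ _ H S hg hl e heC heH h0)
        · exact hstep (good_one K₀ C S₀ _ H S hg hl e heC heH h0)
      · simp only [excA, if_neg heC, if_neg heH] at hneg
        have h0 : conA S e = 0 := by omega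
        exact hstep (good_act K₀ C S₀ _ H S hg hl e heC heH heK h0)
  · have hreach : ∀ u v (p : K₀.Walk u v), (∀ e ∈ p.edges, e ∈ C.edgeSet) →
        ∀ a ∈ p.support, H.Reachable u a := by
      intro u v p hp
      induction p with
      | @nil u =>
        intro a ha
        have : a = u := by simpa using ha
        rw [this]
      | @cons u v t h p ihp =>
        intro a ha
        have h1 := fin_reach H S hg.val _ _ (hg.cle (hp s(u, v) (by simp)))
        rw [SimpleGraph.Walk.support_cons, List.mem_cons] at ha
        rcases ha with rfl | ha
        · exact SimpleGraph.Reachable.refl _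
        · exact h1.trans (ihp (fun e he => hp e (by simp [he])) a ha)
    have hCx : ∀ u v, C.Adj u v → H.Reachable x u := by
      intro u v huv
      have : s(u, v) ∈ w.edges := by
        rw [← SimpleGraph.mem_edgeSet, hCw] at huv; exact huv
      exact hreach x x w (fun e he => by rw [hCw]; exact he) u (w.fst_mem_support_of_mem_edges this)
    have hall : ∀ z ∈ H.support, H.Reachable x z := by
      intro z hz
      by_contra hxz
      exact hstep (good_component K₀ C S₀ _ x H S hg hl hCx z hz hxz)
    constructor
    · have hne : w.edges ≠ [] := by
        intro h
        have := hw.three_le_length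
        rw [← SimpleGraph.Walk.length_edges, h] at this
        simp at this
      obtain ⟨e, he⟩ := List.exists_mem_of_ne_nil _ hne
      have heC : e ∈ C.edgeSet := by rw [hCw]; exact he
      induction e using Sym2.ind with
      | _ u v =>
        have huv := hg.cle heC
        obtain ⟨p⟩ := fin_reach H S hg.val u v huv
        cases p with
        | nil => exact absurd rfl huv.ne
        | cons h p => exact ⟨u, _, h⟩
    · intro u hu v hv
      exact (hall u hu).symm.trans (hall v hv)

/-- If `A` is an activation process of a cycle `C` such that `C` is
contractible in `K(A)`, then there is a nice subprocess `A* ⊆ A` activating `C`, starting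
from a connected graph, such that `C` is contractible in `K(A*)`. -/
theorem statement16 (H : SimpleGraph V) (steps : List (V × V × V)) (C : SimpleGraph V)
    (hA : IsValidProcess H steps) (hC : C ≤ afterGraph H steps)
    (hcon : CycContractible (afterGraph H steps) (facesOf steps) C) :
    ∃ (H' : SimpleGraph V) (steps' : List (V × V × V)),
      Subprocess H' steps' H steps ∧
      NiceProcess H' C steps' ∧
      EdgeConnected H' ∧
      CycContractible (afterGraph H' steps') (facesOf steps') C := by
  obtain ⟨x, w, hw, hCw, hnull⟩ := hcon
  have hval := (valid_iff_val H steps).1 hA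
  have hl : w.support.IsChain C.Adj := by
    have key : ∀ (u v : V) (p : (afterGraph H steps).Walk u v), (∀ e ∈ p.edges, e ∈ C.edgeSet) →
        p.support.IsChain C.Adj := by
      intro u v p hp
      have := (p.transfer C hp).isChain_adj_support
      rwa [SimpleGraph.Walk.support_transfer] at this
    exact key x x w (fun e he => by rw [hCw]; exact he)
  have hgood : Good (afterGraph H steps) C steps w.support H steps :=
    ⟨hval, List.Sublist.refl _, (afterGraph_eq_fin H steps hval).ge,
      by rwa [← afterGraph_eq_fin H steps hval],
      by
        rw [← afterGraph_eq_fin H steps hval]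
        exact gtriv_of_null _ _ _ x hnull⟩
  obtain ⟨H', S', hg, hn, hc⟩ := main_induction (afterGraph H steps) C steps x w hw hCw hl
    _ H steps hgood rfl
  have hfin := afterGraph_eq_fin H' S' hg.val
  have hE : ∀ e ∈ w.edges, e ∈ (afterGraph H' S').edgeSet := by
    intro e he
    rw [hfin]
    apply SimpleGraph.edgeSet_mono hg.cle
    rw [hCw]; exact he
  refine ⟨H', S', ⟨(valid_iff_val _ _).2 hg.val, (le_fin _ _).trans hg.le, hg.sub⟩,
    ⟨(valid_iff_val _ _).2 hg.val, by rw [hfin]; exact hg.cle, by rw [hfin]; exact hn⟩, hc,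
    x, w.transfer _ hE, hw.transfer hE, ?_, ?_⟩
  · rw [SimpleGraph.Walk.edges_transfer, hCw]
  · rw [SimpleGraph.Walk.support_transfer]
    have hs : w.support = x :: w.support.tail := by simp
    have hlast : w.support.getLast? = some x := by
      rw [List.getLast?_eq_some_getLast (by simp), SimpleGraph.Walk.getLast_support]
    rw [hs]
    rw [hs] at hl hlast
    refine null_of_gtriv _ _ _ x ?_ (hl.imp fun u v h => ?_) hlast ?_
    · intro a b c hf
      rw [hfin]
      exact face_adj H' S' hg.val a b c hf
    · rw [hfin]; exact hg.cle h
    · rw [← hs, hfin]; exact hg.triv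



end WSat
end
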